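/- arXiv:1808.08052 — 4 statements merged into one kernel-verified Lean document; each statement's English description precedes it below -/
import Mathlib

section
/- Let U ⊆ ℝ^m and V ⊆ ℝⁿ be open sets, and let ρ : ℝ^m × ℝ × ℝⁿ → ℝⁿ be a map that is twice continuously differentiable on an open neighborhood of U × [0,1) × V. Suppose ρ is transversal to zero on U × [0,1) × V, i.e., for every (c,κ,y) ∈ U × [0,1) × V with ρ(c,κ,y) = 0, the Fréchet derivative of ρ at (c,κ,y), as a linear map from ℝ^m × ℝ × ℝⁿ to ℝⁿ, is surjective. Then for Lebesgue-almost every c ∈ U, the map ρ_c := ρ(c,·,·) is transversal to zero on [0,1) × V, i.e., for every (κ,y) ∈ [0,1) × V with ρ(c,κ,y) = 0, the Fréchet derivative of (κ,y) ↦ ρ(c,κ,y) at (κ,y), as a linear map from ℝ × ℝⁿ to ℝⁿ, is surjective. -/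
open MeasureTheory Set

open Filter Topology Metric

section PSard

local notation "𝔼" k => EuclideanSpace ℝ (Fin k)

lemma psard_box {m : ℕ} (b : OrthonormalBasis (Fin m) ℝ (𝔼 m)) (S : Set (𝔼 m)) (a : 𝔼 m)
    (A : Fin m → ℝ) (h : ∀ y ∈ S, ∀ i, |inner ℝ (b i) (y - a)| ≤ A i) :
    volume S ≤ ∏ i, ENNReal.ofReal (2 * A i) := by
  set T : Set (Fin m → ℝ) := Icc (fun i => inner ℝ (b i) a - A i) (fun i => inner ℝ (b i) a + A i)
  have hmp : MeasurePreserving (fun y : 𝔼 m => (b.repr y).ofLp) volume volume :=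
    (PiLp.volume_preserving_ofLp (Fin m)).comp b.measurePreserving_repr
  have hsub : S ⊆ (fun y : 𝔼 m => (b.repr y).ofLp) ⁻¹' T := by
    intro y hy
    simp only [T, mem_preimage, mem_Icc, Pi.le_def]
    constructor <;> intro i <;> have := abs_le.1 (h y hy i) <;> rw [inner_sub_right] at this <;>
      rw [b.repr_apply_apply] <;> linarith
  calc volume S ≤ _ := measure_mono hsub
    _ = volume T := hmp.measure_preimage measurableSet_Icc.nullMeasurableSet
    _ = _ := by
      rw [Real.volume_Icc_pi]
      congr 1; ext i; congr 1; ring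

lemma psard_box1 {k : ℕ} (v : 𝔼 (k+1)) (hv : ‖v‖ = 1) (S : Set (𝔼 (k+1))) (a : 𝔼 (k+1))
    (A B : ℝ) (hA : 0 ≤ A) (hB : 0 ≤ B)
    (h : ∀ y ∈ S, ‖y - a‖ ≤ A ∧ |inner ℝ v (y - a)| ≤ B) :
    volume S ≤ ENNReal.ofReal (2 ^ (k+1) * A ^ k * B) := by
  have ho : Orthonormal ℝ (({0} : Set (Fin (k+1))).domRestrict (fun _ => v)) := by
    constructor
    · intro i; exact hv
    · intro i j hij; exact absurd (Subsingleton.elim i j) hij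
  obtain ⟨b, hb⟩ := ho.exists_orthonormalBasis_extension_of_card_eq (by simp)
  have hb0 : b 0 = v := hb 0 (by simp)
  refine (psard_box b S a (Fin.cons B (fun _ => A)) ?_).trans_eq ?_
  · intro y hy i
    refine Fin.cases ?_ (fun i => ?_) i
    · simpa [hb0] using (h y hy).2
    · simpa using ((abs_real_inner_le_norm _ _).trans (by simpa using (h y hy).1))
  · rw [← ENNReal.ofReal_prod_of_nonneg]
    · congr 1
      rw [Fin.prod_univ_succ]; simp; ring
    · intro i _
      refine Fin.cases ?_ (fun i => ?_) i <;> simp [hA, hB]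

lemma psard_box2 {k : ℕ} (v w : 𝔼 (k+2)) (hv : ‖v‖ = 1) (hw : ‖w‖ = 1) (hvw : inner ℝ v w = 0)
    (S : Set (𝔼 (k+2))) (a : 𝔼 (k+2))
    (A B : ℝ) (hA : 0 ≤ A) (hB : 0 ≤ B)
    (h : ∀ y ∈ S, ‖y - a‖ ≤ A ∧ |inner ℝ v (y - a)| ≤ B ∧ |inner ℝ w (y - a)| ≤ B) :
    volume S ≤ ENNReal.ofReal (2 ^ (k+2) * A ^ k * B ^ 2) := by
  have ho : Orthonormal ℝ (({0, 1} : Set (Fin (k+2))).domRestrict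
      (Fin.cons v (fun _ => w) : Fin (k+2) → 𝔼 (k+2))) := by
    constructor
    · rintro ⟨i, hi⟩
      rcases hi with rfl | rfl
      · exact hv
      · exact hw
    · rintro ⟨i, hi⟩ ⟨j, hj⟩ hij
      rcases hi with rfl | rfl <;> rcases hj with rfl | rfl
      · simp at hij
      · exact hvw
      · rw [real_inner_comm]; exact hvw
      · simp at hij
  obtain ⟨b, hb⟩ := ho.exists_orthonormalBasis_extension_of_card_eq (by simp)
  have hb0 : b 0 = v := hb 0 (by simp)
  have hb1 : b 1 = w := hb 1 (by simp)
  refine (psard_box b S a (Fin.cons B (Fin.cons B (fun _ => A))) ?_).trans_eq ?_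
  · intro y hy i
    refine Fin.cases ?_ (fun i => ?_) i
    · simpa [hb0] using (h y hy).2.1
    · refine Fin.cases ?_ (fun i => ?_) i
      · simpa [hb1] using (h y hy).2.2
      · simpa using ((abs_real_inner_le_norm _ _).trans (by simpa using (h y hy).1))
  · rw [← ENNReal.ofReal_prod_of_nonneg]
    · congr 1
      rw [Fin.prod_univ_succ, Fin.prod_univ_succ]; simp; ring
    · intro i _
      refine Fin.cases ?_ (fun i => Fin.cases ?_ (fun i => ?_) i) i <;> simp [hA, hB]

lemma psard_cover {l m : ℕ} (f : (𝔼 l) → (𝔼 m)) (s : Set (𝔼 l)) (K : NNReal)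
    (h : ∀ x ∈ s, ∀ᶠ r in 𝓝[>] (0:ℝ), volume (f '' closedBall x r) ≤ K * volume (closedBall x r)) :
    volume (f '' s) ≤ K * volume s := by
  have key : ∀ ε : NNReal, 0 < ε → volume (f '' s) ≤ K * (volume s + ε) := by
    intro ε hε
    obtain ⟨t, r, htc, hts, hr, hcov, hsum⟩ := Besicovitch.exists_closedBall_covering_tsum_measure_le
      (volume : Measure (𝔼 l)) (ε := ε) (by exact_mod_cast hε.ne')
      (fun x => {r | volume (f '' closedBall x r) ≤ K * volume (closedBall x r)}) s (by
        intro x hx δ hδ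
        exact ((h x hx).and (Ioo_mem_nhdsGT hδ)).exists)
    have : Countable t := htc
    calc volume (f '' s) ≤ volume (⋃ x : t, f '' closedBall x (r x)) := by
          apply measure_mono
          rw [← image_iUnion]
          apply image_mono
          rwa [biUnion_eq_iUnion] at hcov
      _ ≤ ∑' x : t, volume (f '' closedBall (x : 𝔼 l) (r x)) := measure_iUnion_le _
      _ ≤ ∑' x : t, K * volume (closedBall (x : 𝔼 l) (r x)) :=
          ENNReal.tsum_le_tsum (fun x => hr x x.2)
      _ = K * ∑' x : t, volume (closedBall (x : 𝔼 l) (r x)) := ENNReal.tsum_mul_left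
      _ ≤ _ := by gcongr
  have hlim : Tendsto (fun ε : NNReal => (K:ENNReal) * (volume s + ε)) (𝓝[>] 0)
      (𝓝 (K * (volume s + (0:NNReal)))) := by
    refine ENNReal.Tendsto.const_mul ?_ (Or.inr ENNReal.coe_ne_top)
    exact tendsto_const_nhds.add (ENNReal.tendsto_coe.2 (tendsto_id.mono_left nhdsWithin_le_nhds))
  have := ge_of_tendsto hlim (eventually_nhdsWithin_of_forall (fun ε hε => key ε hε))
  simpa using this

/-- from real bounds to measure bounds -/
lemma psard_conv {k m : ℕ} (f : (𝔼 (k+1)) → (𝔼 m)) (x : 𝔼 (k+1)) :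
    ∃ c : ℝ, 0 < c ∧ ∀ δ : NNReal, ∀ r : ℝ, 0 < r →
      volume (f '' closedBall x r) ≤ ENNReal.ofReal (δ * c * r ^ (k+1)) →
      volume (f '' closedBall x r) ≤ δ * volume (closedBall x r) := by
  have hfin : volume (ball (0: 𝔼 (k+1)) 1) ≠ ⊤ := measure_ball_lt_top.ne
  have hpos : 0 < volume (ball (0: 𝔼 (k+1)) 1) := measure_ball_pos _ _ one_pos
  refine ⟨(volume (ball (0: 𝔼 (k+1)) 1)).toReal, ENNReal.toReal_pos hpos.ne' hfin,
    fun δ r hr h => ?_⟩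
  refine h.trans_eq ?_
  rw [Measure.addHaar_closedBall _ _ hr.le, ENNReal.ofReal_mul (by positivity),
    ENNReal.ofReal_mul (by positivity), ENNReal.ofReal_toReal hfin]
  simp
  ring

/-- density points determine derivatives -/
lemma psard_density {l : ℕ} (C : Set (𝔼 l)) (x : 𝔼 l)
    (hx : Tendsto (fun r => volume (C ∩ closedBall x r) / volume (closedBall x r)) (𝓝[>] 0) (𝓝 1))
    (φ : (𝔼 l) → ℝ) (L : (𝔼 l) →L[ℝ] ℝ) (hφ : HasFDerivAt φ L x) (hφx : φ x = 0)
    (hC : ∀ᶠ y in 𝓝 x, y ∈ C → φ y = 0) : L = 0 := by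
  ext z
  show L z = 0
  by_contra hz
  have hz' : 0 < |L z| := abs_pos.2 hz
  -- choose ε
  obtain ⟨ε, hε, hε2⟩ : ∃ ε : ℝ, 0 < ε ∧ ‖L‖ * ε + ε * (‖z‖ + ε) < |L z| := by
    have : Tendsto (fun ε : ℝ => ‖L‖ * ε + ε * (‖z‖ + ε)) (𝓝[>] 0) (𝓝 (‖L‖ * 0 + 0 * (‖z‖ + 0))) := by
      apply Tendsto.mono_left _ nhdsWithin_le_nhds
      exact Continuous.tendsto (by fun_prop) 0
    simp only [mul_zero, zero_mul, add_zero] at this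
    obtain ⟨ε, h1, h2⟩ := ((this.eventually (gt_mem_nhds hz')).and self_mem_nhdsWithin).exists
    exact ⟨ε, h2, h1⟩
  have B₁ := Measure.eventually_nonempty_inter_smul_of_density_one volume C x hx (closedBall z ε)
    measurableSet_closedBall (measure_closedBall_pos volume z hε).ne'
  have hev : ∀ᶠ y in 𝓝 x, (y ∈ C → φ y = 0) ∧ ‖φ y - φ x - L (y - x)‖ ≤ ε * ‖y - x‖ :=
    hC.and (hφ.isLittleO.def hε)
  obtain ⟨ρ, hρ, hρ2⟩ := Metric.eventually_nhds_iff.1 hev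
  have B₂ : ∀ᶠ r in 𝓝[>] (0:ℝ), r * (‖z‖ + ε) < ρ := by
    have : Tendsto (fun r : ℝ => r * (‖z‖ + ε)) (𝓝[>] 0) (𝓝 (0 * (‖z‖ + ε))) := by
      apply Tendsto.mono_left _ nhdsWithin_le_nhds
      exact Continuous.tendsto (by fun_prop) 0
    rw [zero_mul] at this
    exact this.eventually (gt_mem_nhds hρ)
  obtain ⟨r, ⟨⟨y, hyC, hy⟩, hr2⟩, hr⟩ := ((B₁.and B₂).and self_mem_nhdsWithin).exists
  replace hr : 0 < r := hr
  rw [singleton_add, mem_image] at hy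
  obtain ⟨w, hw, rfl⟩ := hy
  obtain ⟨z', hz1, rfl⟩ := mem_smul_set.1 hw
  have hzz : ‖z' - z‖ ≤ ε := by simpa [dist_eq_norm] using hz1
  have hzn : ‖z'‖ ≤ ‖z‖ + ε := by
    have := norm_add_le (z' - z) z
    simp only [sub_add_cancel] at this; linarith
  have hnorm : ‖r • z'‖ ≤ r * (‖z‖ + ε) := by
    rw [norm_smul, Real.norm_of_nonneg hr.le]; gcongr
  obtain ⟨h1, h2⟩ := @hρ2 (x + r • z') (by simpa [dist_eq_norm] using hnorm.trans_lt hr2)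
  rw [h1 hyC, hφx] at h2
  simp only [add_sub_cancel_left, sub_self, zero_sub, norm_neg, map_smul, norm_smul, smul_eq_mul, norm_mul, Real.norm_of_nonneg hr.le] at h2
  have h3 : ‖L z'‖ ≤ ε * ‖z'‖ := by
    have : r * ‖L z'‖ ≤ r * (ε * ‖z'‖) := by linarith
    exact le_of_mul_le_mul_left this hr
  have h4 : ‖L (z' - z)‖ ≤ ‖L‖ * ε := (L.le_opNorm _).trans (by gcongr)
  have h5 : |L z| ≤ ‖L z'‖ + ‖L (z' - z)‖ := by
    have : L z = L z' - L (z' - z) := by simp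
    rw [← Real.norm_eq_abs, this]; exact norm_sub_le _ _
  have h6 : ε * ‖z'‖ ≤ ε * (‖z‖ + ε) := by gcongr
  linarith


lemma psard_taylor {l m : ℕ} (f : (𝔼 l) → (𝔼 m)) (x : 𝔼 l) (hf : ContDiffAt ℝ 2 f x) :
    ∃ M : ℝ, 0 ≤ M ∧ ∃ ρ > 0, ∀ r, 0 < r → r < ρ → ∀ y ∈ closedBall x r,
      ‖f y - f x - fderiv ℝ f x (y - x)‖ ≤ M * r ^ 2 := by
  have h1 : ContDiffAt ℝ 1 (fderiv ℝ f) x := hf.fderiv_right (by norm_num)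
  obtain ⟨K, t, ht, hK⟩ := h1.exists_lipschitzOnWith
  have hd : ∀ᶠ y in 𝓝 x, y ∈ t ∧ DifferentiableAt ℝ f y :=
    (eventually_mem_set.2 ht).and
      ((hf.eventually (by simp)).mono (fun y hy => hy.differentiableAt (by simp)))
  obtain ⟨ρ, hρ, H⟩ := Metric.eventually_nhds_iff.1 hd
  refine ⟨K, K.2, ρ, hρ, fun r hr hrρ y hy => ?_⟩
  have hmem : ∀ z ∈ closedBall x r, z ∈ t ∧ DifferentiableAt ℝ f z := fun z hz =>
    H (lt_of_le_of_lt (mem_closedBall.1 hz) hrρ)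
  have := (convex_closedBall x r).norm_image_sub_le_of_norm_hasFDerivWithin_le'
    (f := f) (f' := fderiv ℝ f) (φ := fderiv ℝ f x) (C := K * r)
    (fun z hz => (hmem z hz).2.hasFDerivAt.hasFDerivWithinAt)
    (fun z hz => by
      have := hK.norm_sub_le (hmem z hz).1 (hmem x (mem_closedBall_self hr.le)).1
      refine this.trans ?_
      have : ‖z - x‖ ≤ r := by simpa [dist_eq_norm] using hz
      gcongr) (mem_closedBall_self hr.le) hy
  refine this.trans ?_
  have h3 : ‖y - x‖ ≤ r := by simpa [dist_eq_norm] using hy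
  calc K * r * ‖y - x‖ ≤ K * r * r := by gcongr
    _ = _ := by ring

lemma psard_normal {E : Type*} [NormedAddCommGroup E] [NormedSpace ℝ E] {m : ℕ}
    (P : E →L[ℝ] (𝔼 m)) (hP : ¬ Function.Surjective P) :
    ∃ v : 𝔼 m, ‖v‖ = 1 ∧ ∀ h, inner ℝ v (P h) = 0 := by
  set R := P.toLinearMap.range
  have hR : R ≠ ⊤ := fun h => hP (LinearMap.range_eq_top.1 h)
  have hR' : Rᗮ ≠ ⊥ := fun h => hR (Submodule.orthogonal_eq_bot_iff.1 h)
  obtain ⟨w, hw, hw0⟩ := Submodule.exists_mem_ne_zero_of_ne_bot hR'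
  refine ⟨‖w‖⁻¹ • w, norm_smul_inv_norm hw0, fun h => ?_⟩
  rw [inner_smul_left, real_inner_comm, (Submodule.mem_orthogonal R w).1 hw (P h) ⟨h, rfl⟩]
  simp

lemma psard_normal2 {E : Type*} [NormedAddCommGroup E] [NormedSpace ℝ E] {m : ℕ}
    (P : E →L[ℝ] (𝔼 m)) (v : 𝔼 m) (hv : ‖v‖ = 1) (hvP : ∀ h, inner ℝ v (P h) = 0) :
    (∃ w : 𝔼 m, ‖w‖ = 1 ∧ inner ℝ v w = 0 ∧ ∀ h, inner ℝ w (P h) = 0) ∨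
    ∀ y, inner ℝ v y = 0 → ∃ h, P h = y := by
  by_cases h : Function.Surjective (P.coprod (ContinuousLinearMap.toSpanSingleton ℝ v))
  · right
    intro y hy
    obtain ⟨⟨a, t⟩, hat⟩ := h y
    simp only [ContinuousLinearMap.coprod_apply, ContinuousLinearMap.toSpanSingleton_apply] at hat
    have : t = 0 := by
      rw [← hat, inner_add_right, hvP, inner_smul_right, real_inner_self_eq_norm_sq, hv] at hy
      simpa using hy
    exact ⟨a, by simpa [this] using hat⟩
  · left
    obtain ⟨w, hw, hwP⟩ := psard_normal _ h
    refine ⟨w, hw, ?_, fun h => ?_⟩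
    · have := hwP (0, 1)
      rw [real_inner_comm]
      simpa using this
    · have := hwP (h, 0)
      simpa using this

/-- basic geometric bound -/
lemma psard_basic {l m : ℕ} (f : (𝔼 l) → (𝔼 m)) (x : 𝔼 l) (hf : ContDiffAt ℝ 2 f x) :
    ∃ M : ℝ, 0 ≤ M ∧ ∃ ρ > 0, ∀ r, 0 < r → r < ρ → ∀ y ∈ closedBall x r,
      ‖f y - f x - fderiv ℝ f x (y - x)‖ ≤ M * r ^ 2 ∧ ‖f y - f x‖ ≤ (‖fderiv ℝ f x‖ + M) * r ∧
      ∀ v : 𝔼 m, ‖v‖ = 1 → (∀ h, inner ℝ v (fderiv ℝ f x h) = 0) →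
        |inner ℝ v (f y - f x)| ≤ M * r ^ 2 := by
  obtain ⟨M, hM, ρ, hρ, H⟩ := psard_taylor f x hf
  refine ⟨M, hM, min ρ 1, by positivity, fun r hr hrρ y hy => ?_⟩
  have h1 := H r hr (hrρ.trans_le (min_le_left _ _)) y hy
  have hr1 : r ≤ 1 := (hrρ.trans_le (min_le_right _ _)).le
  refine ⟨h1, ?_, fun v hv hvP => ?_⟩
  · have h3 : ‖y - x‖ ≤ r := by simpa [dist_eq_norm] using hy
    have h2 : ‖fderiv ℝ f x (y - x)‖ ≤ ‖fderiv ℝ f x‖ * r :=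
      ((fderiv ℝ f x).le_opNorm _).trans (by gcongr)
    have h4 := norm_add_le (f y - f x - fderiv ℝ f x (y - x)) (fderiv ℝ f x (y - x))
    rw [sub_add_cancel] at h4
    nlinarith [mul_nonneg hM hr.le]
  · have : inner ℝ v (f y - f x) = inner ℝ v (f y - f x - fderiv ℝ f x (y - x)) := by
      rw [inner_sub_right _ (f y - f x), hvP, sub_zero]
    rw [this]
    refine (abs_real_inner_le_norm _ _).trans ?_
    rw [hv, one_mul]; exact h1

lemma psard_all {k : ℕ} (f : (𝔼 (k+2)) → (𝔼 (k+1))) (x : 𝔼 (k+2)) (hf : ContDiffAt ℝ 2 f x)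
    (hx : ¬ Function.Surjective (fderiv ℝ f x)) :
    ∃ K : NNReal, ∀ᶠ r in 𝓝[>] (0:ℝ),
      volume (f '' closedBall x r) ≤ K * volume (closedBall x r) := by
  obtain ⟨v, hv, hvP⟩ := psard_normal _ hx
  obtain ⟨M, hM, ρ, hρ, H⟩ := psard_basic f x hf
  obtain ⟨c, hc, hconv⟩ := psard_conv f x
  set L := ‖fderiv ℝ f x‖ + M
  have hL : 0 ≤ L := by positivity
  refine ⟨⟨2 ^ (k+1) * L ^ k * M / c, by positivity⟩, ?_⟩
  filter_upwards [Ioo_mem_nhdsGT hρ] with r hr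
  apply hconv _ _ hr.1
  refine (psard_box1 v hv _ (f x) (L * r) (M * r^2) (mul_nonneg hL hr.1.le) (by positivity) ?_).trans_eq ?_
  · rintro _ ⟨y, hy, rfl⟩
    have := H r hr.1 hr.2 y hy
    exact ⟨this.2.1, this.2.2 v hv hvP⟩
  · congr 1
    show _ = (2 ^ (k+1) * L ^ k * M / c) * c * r ^ (k+1+1)
    rw [div_mul_cancel₀ _ hc.ne']
    ring

lemma psard_good1 {k : ℕ} (f : (𝔼 (k+2)) → (𝔼 (k+1))) (x : 𝔼 (k+2)) (hf : ContDiffAt ℝ 2 f x)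
    (v w : 𝔼 (k+1)) (hv : ‖v‖ = 1) (hw : ‖w‖ = 1) (hvw : inner ℝ v w = 0)
    (hvP : ∀ h, inner ℝ v (fderiv ℝ f x h) = 0) (hwP : ∀ h, inner ℝ w (fderiv ℝ f x h) = 0)
    (δ : NNReal) (hδ : 0 < δ) : ∀ᶠ r in 𝓝[>] (0:ℝ),
      volume (f '' closedBall x r) ≤ δ * volume (closedBall x r) := by
  obtain ⟨M, hM, ρ, hρ, H⟩ := psard_basic f x hf
  obtain ⟨c, hc, hconv⟩ := psard_conv f x
  set L := ‖fderiv ℝ f x‖ + M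
  have hL : 0 ≤ L := by positivity
  rcases k with _ | k
  · exfalso
    have : Orthonormal ℝ ![v, w] := by
      simp [orthonormal_vecCons_iff, hv, hw, hvw]
    have := this.linearIndependent.fintype_card_le_finrank
    simp at this
  set D := 2 ^ (k+2) * L ^ k * M ^ 2
  have hD : 0 ≤ D := by positivity
  have hη : 0 < δ * c / (D + 1) := by positivity
  filter_upwards [Ioo_mem_nhdsGT hρ, Ioo_mem_nhdsGT hη] with r hr hr2
  apply hconv _ _ hr.1
  refine (psard_box2 v w hv hw hvw _ (f x) (L * r) (M * r^2) (mul_nonneg hL hr.1.le) (by positivity) ?_).trans ?_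
  · rintro _ ⟨y, hy, rfl⟩
    have := H r hr.1 hr.2 y hy
    exact ⟨this.2.1, this.2.2 v hv hvP, this.2.2 w hw hwP⟩
  · apply ENNReal.ofReal_le_ofReal
    have h1 : r * (D + 1) ≤ δ * c := ((lt_div_iff₀ (by positivity)).1 hr2.2).le
    have h0 := hr.1
    calc 2 ^ (k+2) * (L * r) ^ k * (M * r^2)^2 = (r * D) * r ^ (k+3) := by simp only [D]; ring
      _ ≤ (r * (D + 1)) * r ^ (k+3) := by gcongr; linarith
      _ ≤ _ := by gcongr


lemma psard_inv (A : Type*) [NormedRing A] [NormedAlgebra ℝ A] [CompleteSpace A] :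
    HasFDerivAt (Ring.inverse : A → A) (-ContinuousLinearMap.id ℝ A) 1 := by
  have := hasFDerivAt_ringInverse (𝕜 := ℝ) (1 : Aˣ)
  rw [Units.val_one] at this
  refine this.congr_fderiv ?_
  ext a
  simp

lemma psard_section {E : Type*} [NormedAddCommGroup E] [NormedSpace ℝ E] {m : ℕ}
    (P : E →L[ℝ] (𝔼 m)) (v : 𝔼 m) (hv : ‖v‖ = 1) (hvP : ∀ h, inner ℝ v (P h) = 0)
    (hR : ∀ y, inner ℝ v y = 0 → ∃ h, P h = y) :
    ∃ s : (𝔼 m) →L[ℝ] E, s v = 0 ∧ ∀ y, P (s y) = y - inner ℝ v y • v := by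
  have hvv : inner ℝ v v = (1:ℝ) := by rw [real_inner_self_eq_norm_sq, hv]; norm_num
  set T := (P.coprod (ContinuousLinearMap.toSpanSingleton ℝ v)).toLinearMap
  have hT : T.range = ⊤ := by
    rw [LinearMap.range_eq_top]
    intro y
    obtain ⟨h, hh⟩ := hR (y - inner ℝ v y • v) (by
      rw [inner_sub_right, inner_smul_right, hvv]; ring)
    exact ⟨(h, inner ℝ v y), by simp [T, hh]⟩
  obtain ⟨τ, hτ⟩ := T.exists_rightInverse_of_surjective hT
  have h1 : ∀ y, P (τ y).1 = y - inner ℝ v y • v := by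
    intro y
    have h2 : P (τ y).1 + (τ y).2 • v = y := by
      have := LinearMap.congr_fun hτ y
      simpa [T] using this
    have h3 : (τ y).2 = inner ℝ v y := by
      have h4 : inner ℝ v y = inner ℝ v (P (τ y).1 + (τ y).2 • v) := by rw [h2]
      rw [h4, inner_add_right, hvP, inner_smul_right, hvv]; ring
    rw [← h3]; exact eq_sub_of_add_eq h2
  set Q : (𝔼 m) →L[ℝ] (𝔼 m) := ContinuousLinearMap.id ℝ _ - (innerSL ℝ v).smulRight v
  have hQ : ∀ y, Q y = y - inner ℝ v y • v := fun y => by simp [Q]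
  refine ⟨(LinearMap.toContinuousLinearMap ((LinearMap.fst ℝ E ℝ) ∘ₗ τ)) ∘L Q, ?_, fun y => ?_⟩
  · have : Q v = 0 := by rw [hQ, hvv]; simp
    simp [this]
  · simp only [ContinuousLinearMap.comp_apply, LinearMap.coe_toContinuousLinearMap',
      LinearMap.comp_apply, LinearMap.fst_apply]
    rw [h1, hQ, inner_sub_right, inner_smul_right, hvv]
    simp

lemma psard_second {l m : ℕ} (f : (𝔼 l) → (𝔼 m)) (C : Set (𝔼 l)) (x : 𝔼 l)
    (hC : ∀ y ∈ C, ¬ Function.Surjective (fderiv ℝ f y))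
    (hx : Tendsto (fun r => volume (C ∩ closedBall x r) / volume (closedBall x r)) (𝓝[>] 0) (𝓝 1))
    (hf : ContDiffAt ℝ 2 f x)
    (v : 𝔼 m) (hv : ‖v‖ = 1) (s : (𝔼 m) →L[ℝ] (𝔼 l)) (hsv : s v = 0)
    (hs : ∀ y, fderiv ℝ f x (s y) = y - inner ℝ v y • v)
    (k : 𝔼 l) (hk : fderiv ℝ f x k = 0) (h : 𝔼 l) :
    inner ℝ v (fderiv ℝ (fderiv ℝ f) x h k) = 0 := by
  have hvv : inner ℝ v v = (1:ℝ) := by rw [real_inner_self_eq_norm_sq, hv]; norm_num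
  set ι : (𝔼 m) →L[ℝ] (𝔼 l) := s + (innerSL ℝ v).smulRight k
  set J : (𝔼 m) →L[ℝ] (𝔼 m) := (innerSL ℝ v).smulRight v
  set N : (𝔼 l) → ((𝔼 m) →L[ℝ] (𝔼 m)) := fun y => (fderiv ℝ f y) ∘L ι + J
  have hNx : N x = 1 := by
    ext1 y
    simp [N, ι, J, hs, hk]
  have h2 : HasFDerivAt (fderiv ℝ f) (fderiv ℝ (fderiv ℝ f) x) x :=
    ((hf.fderiv_right (m := 1) (by norm_num)).differentiableAt (by simp)).hasFDerivAt
  set R := (ContinuousLinearMap.compL ℝ (𝔼 m) (𝔼 l) (𝔼 m)).flip ι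
  have hN : HasFDerivAt N (R ∘L (fderiv ℝ (fderiv ℝ f) x)) x := by
    have := (R.hasFDerivAt.comp x h2).add_const J
    exact this
  have hinv : HasFDerivAt (Ring.inverse : ((𝔼 m) →L[ℝ] (𝔼 m)) → _)
      (-ContinuousLinearMap.id ℝ ((𝔼 m) →L[ℝ] (𝔼 m))) (N x) := by
    rw [hNx]
    exact psard_inv _
  set ev : ((𝔼 m) →L[ℝ] (𝔼 m)) →L[ℝ] ℝ := (innerSL ℝ v) ∘L (ContinuousLinearMap.apply ℝ (𝔼 m) v)
  have hφ := (ev.hasFDerivAt.comp x (hinv.comp x hN)).const_sub 1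
  have hzero := psard_density C x hx _ _ hφ ?_ ?_
  · have := congrArg (fun L : (𝔼 l) →L[ℝ] ℝ => L h) hzero
    have hv0 : v ≠ 0 := by rintro rfl; simp at hv
    simpa [ev, R, ι, hsv, hv0, hv] using this
  · simp [ev, hNx, hv]
  · have hu : ∀ᶠ y in 𝓝 x, IsUnit (N y) := by
      have : {A : (𝔼 m) →L[ℝ] (𝔼 m) | IsUnit A} ∈ 𝓝 (N x) :=
        Units.isOpen.mem_nhds (by rw [hNx]; exact isUnit_one)
      exact hN.continuousAt this
    filter_upwards [hu] with y hy hyC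
    by_contra hne
    apply hC y hyC
    set I := Ring.inverse (N y)
    have hI : ∀ z, N y (I z) = z := fun z => by
      have := Ring.mul_inverse_cancel _ hy
      exact congrArg (fun A : (𝔼 m) →L[ℝ] (𝔼 m) => A z) this
    have h3 : ∀ z, fderiv ℝ f y (ι (I z)) = z - inner ℝ v (I z) • v := by
      intro z
      have := hI z
      have h4 : N y (I z) = fderiv ℝ f y (ι (I z)) + inner ℝ v (I z) • v := by simp [N, J]
      rw [h4] at this
      exact eq_sub_of_add_eq this
    set c : ℝ := 1 - inner ℝ v (I v)
    have hc : c ≠ 0 := by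
      simpa [ev] using hne
    intro z
    refine ⟨ι (I z) + (inner ℝ v (I z) / c) • ι (I v), ?_⟩
    rw [map_add, map_smul, h3, h3]
    have : v - inner ℝ v (I v) • v = c • v := by simp [c, sub_smul]
    rw [this, smul_smul, div_mul_cancel₀ _ hc]
    simp


/-- variation of the normal component along the kernel directions -/
lemma psard_kervar {l m : ℕ} (f : (𝔼 l) → (𝔼 m)) (x : 𝔼 l) (hf : ContDiffAt ℝ 2 f x)
    (v : 𝔼 m) (hv : ‖v‖ = 1) (hvP : ∀ h, inner ℝ v (fderiv ℝ f x h) = 0)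
    (H : ∀ k, fderiv ℝ f x k = 0 → ∀ h, inner ℝ v (fderiv ℝ (fderiv ℝ f) x h k) = 0)
    (ε : ℝ) (hε : 0 < ε) : ∃ ρ > 0, ∀ r, r < ρ → ∀ a ∈ closedBall x r, ∀ b ∈ closedBall x r,
      fderiv ℝ f x (b - a) = 0 → |inner ℝ v (f b - f a)| ≤ ε * r * ‖b - a‖ := by
  have h2 : HasFDerivAt (fderiv ℝ f) (fderiv ℝ (fderiv ℝ f) x) x :=
    ((hf.fderiv_right (m := 1) (by norm_num)).differentiableAt (by simp)).hasFDerivAt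
  have hd : ∀ᶠ y in 𝓝 x, ‖fderiv ℝ f y - fderiv ℝ f x - fderiv ℝ (fderiv ℝ f) x (y - x)‖ ≤
      ε * ‖y - x‖ ∧ DifferentiableAt ℝ f y :=
    (h2.isLittleO.def hε).and
      ((hf.eventually (by simp)).mono (fun y hy => hy.differentiableAt (by simp)))
  obtain ⟨ρ, hρ, hh⟩ := Metric.eventually_nhds_iff.1 hd
  refine ⟨ρ, hρ, fun r hr a ha b hb hab => ?_⟩
  have hmem : ∀ t ∈ Icc (0:ℝ) 1, a + t • (b - a) ∈ closedBall x r := by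
    intro t ht
    have := (convex_closedBall x r).add_smul_sub_mem ha hb ht
    exact this
  have hD : ∀ t ∈ Icc (0:ℝ) 1, HasDerivWithinAt (fun t : ℝ => inner ℝ v (f (a + t • (b - a))))
      (inner ℝ v (fderiv ℝ f (a + t • (b - a)) (b - a))) (Icc (0:ℝ) 1) t := by
    intro t ht
    have h3 : HasFDerivAt f (fderiv ℝ f (a + t • (b - a))) (a + t • (b - a)) :=
      (hh ((mem_closedBall.1 (hmem t ht)).trans_lt hr)).2.hasFDerivAt
    have h4 : HasDerivAt (fun t : ℝ => a + t • (b - a)) (b - a) t := by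
      have := ((hasDerivAt_id t).smul_const (b - a)).const_add a
      simpa using this
    have h5 := h3.comp_hasDerivAt t h4
    have h6 := (innerSL ℝ v).hasFDerivAt.comp_hasDerivAt t h5
    exact h6.hasDerivWithinAt
  have := norm_image_sub_le_of_norm_deriv_le_segment_01' (C := ε * r * ‖b - a‖) hD (by
    intro t ht
    have ht' := hmem t (Ico_subset_Icc_self ht)
    set z := a + t • (b - a)
    have h3 := (hh ((mem_closedBall.1 ht').trans_lt hr)).1
    have hz : ‖z - x‖ ≤ r := by simpa [dist_eq_norm] using ht'
    have h4 : inner ℝ v (fderiv ℝ f z (b - a)) = inner ℝ v ((fderiv ℝ f z - fderiv ℝ f x -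
        fderiv ℝ (fderiv ℝ f) x (z - x)) (b - a)) := by
      simp only [_root_.sub_apply, inner_sub_right v, H _ hab, hvP, sub_zero]
    rw [h4]
    refine (norm_inner_le_norm _ _).trans ?_
    rw [hv, one_mul]
    refine (ContinuousLinearMap.le_opNorm _ _).trans ?_
    have : ε * ‖z - x‖ ≤ ε * r := by gcongr
    gcongr
    exact h3.trans this)
  simpa [inner_sub_right] using this

lemma psard_shear {l m : ℕ} (f : (𝔼 l) → (𝔼 m)) (x : 𝔼 l) (hf : ContDiffAt ℝ 2 f x)
    (v : 𝔼 m) (hvP : ∀ h, inner ℝ v (fderiv ℝ f x h) = 0) (s : (𝔼 m) →L[ℝ] (𝔼 l)) :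
    ∃ ρ > 0, ∀ Y ⊆ ball (0 : 𝔼 m) ρ,
      volume ((fun y => f x + y + (inner ℝ v (f (x + s y) - f x) : ℝ) • v) '' Y) ≤ 2 * volume Y := by
  set S : (𝔼 m) → (𝔼 m) := fun y => f x + y + (inner ℝ v (f (x + s y) - f x) : ℝ) • v
  have h1 : HasStrictFDerivAt f (fderiv ℝ f x) x := hf.hasStrictFDerivAt (by simp)
  have hS : HasStrictFDerivAt S (ContinuousLinearMap.id ℝ (𝔼 m)) 0 := by
    have h2 : HasStrictFDerivAt (fun y => x + s y) s (0 : 𝔼 m) := s.hasStrictFDerivAt.const_add x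
    have h3 : HasStrictFDerivAt (fun y => f (x + s y)) ((fderiv ℝ f x) ∘L s) (0 : 𝔼 m) := by
      refine HasStrictFDerivAt.comp (g := f) (f := fun y => x + s y) 0 ?_ h2
      simpa using h1
    have h4 := (innerSL ℝ v).hasStrictFDerivAt.comp 0 (h3.sub_const (f x))
    have h5 := ((hasStrictFDerivAt_id (𝕜 := ℝ) (0 : 𝔼 m)).const_add (f x)).add (h4.smul_const v)
    refine h5.congr_fderiv ?_
    ext1 y
    simp [hvP]
  have hdet := addHaar_image_le_mul_of_det_lt (volume : Measure (𝔼 m))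
    (ContinuousLinearMap.id ℝ (𝔼 m)) (m := 2) (by simp [ContinuousLinearMap.det])
  obtain ⟨δ, hδ, hδ0⟩ := (hdet.and self_mem_nhdsWithin).exists
  obtain ⟨t, ht, hap⟩ := hS.approximates_deriv_on_nhds (c := δ) (Or.inr hδ0)
  obtain ⟨ρ, hρ, hsub⟩ := Metric.mem_nhds_iff.1 ht
  exact ⟨ρ, hρ, fun Y hY => hδ Y S (hap.mono_set (hY.trans hsub))⟩

lemma psard_good2 {k : ℕ} (f : (𝔼 (k+2)) → (𝔼 (k+1))) (C : Set (𝔼 (k+2))) (x : 𝔼 (k+2))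
    (hC : ∀ y ∈ C, ¬ Function.Surjective (fderiv ℝ f y))
    (hx : Tendsto (fun r => volume (C ∩ closedBall x r) / volume (closedBall x r)) (𝓝[>] 0) (𝓝 1))
    (hf : ContDiffAt ℝ 2 f x)
    (v : 𝔼 (k+1)) (hv : ‖v‖ = 1) (hvP : ∀ h, inner ℝ v (fderiv ℝ f x h) = 0)
    (hR : ∀ y, inner ℝ v y = 0 → ∃ h, fderiv ℝ f x h = y)
    (δ : NNReal) (hδ : 0 < δ) : ∀ᶠ r in 𝓝[>] (0:ℝ),
      volume (f '' closedBall x r) ≤ δ * volume (closedBall x r) := by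
  have hvv : inner ℝ v v = (1:ℝ) := by rw [real_inner_self_eq_norm_sq, hv]; norm_num
  obtain ⟨s, hsv, hs⟩ := psard_section _ v hv hvP hR
  have H2 : ∀ k, fderiv ℝ f x k = 0 → ∀ h, inner ℝ v (fderiv ℝ (fderiv ℝ f) x h k) = 0 :=
    fun k hk h => psard_second f C x hC hx hf v hv s hsv hs k hk h
  obtain ⟨M, hM, ρ₁, hρ₁, Hb⟩ := psard_basic f x hf
  obtain ⟨c, hc, hconv⟩ := psard_conv f x
  obtain ⟨ρ₂, hρ₂, Hs⟩ := psard_shear f x hf v hvP s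
  set P := fderiv ℝ f x
  set L := ‖P‖ + M
  have hL : 0 ≤ L := by positivity
  set A := 2 * L + 1
  have hA : 0 < A := by positivity
  -- radius factor
  set C0 := 1 + ‖s‖ * L
  have hC0 : 0 < C0 := by positivity
  set D := 2 * C0 ^ 2 + ‖s‖ * M
  have hD : 0 < D := by positivity
  set ε := δ * c / (2 ^ (k+2) * A ^ k * D)
  have hε : 0 < ε := by positivity
  obtain ⟨ρ₃, hρ₃, Hk⟩ := psard_kervar f x hf v hv hvP H2 ε hε
  have hg : HasStrictFDerivAt (fun y => (inner ℝ v (f y) : ℝ)) (0 : (𝔼 (k+2)) →L[ℝ] ℝ) x := by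
    have h1 : HasStrictFDerivAt f (fderiv ℝ f x) x := hf.hasStrictFDerivAt (by simp)
    have h2 := (innerSL ℝ v).hasStrictFDerivAt.comp x h1
    refine h2.congr_fderiv ?_
    ext1 y
    exact hvP y
  obtain ⟨t, ht, hap⟩ := hg.approximates_deriv_on_nhds (c := ⟨ε, hε.le⟩) (Or.inr hε)
  obtain ⟨ρ₄, hρ₄, hρt⟩ := Metric.mem_nhds_iff.1 ht
  have e3 : 0 < ρ₃ / C0 := by positivity
  have e4 : 0 < ρ₄ / C0 := by positivity
  have e2 : 0 < ρ₂ / A := by positivity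
  have e5 : 0 < 1 / (ε * D) := by positivity
  filter_upwards [Ioo_mem_nhdsGT hρ₁, Ioo_mem_nhdsGT e2, Ioo_mem_nhdsGT e3, Ioo_mem_nhdsGT e4,
    Ioo_mem_nhdsGT e5] with r hr1 hr2 hr3 hr4 hr5
  have hr : 0 < r := hr1.1
  have hr2 : r * A < ρ₂ := (lt_div_iff₀ hA).1 hr2.2
  have hr3 : r * C0 < ρ₃ := (lt_div_iff₀ hC0).1 hr3.2
  have hr4 : r * C0 < ρ₄ := (lt_div_iff₀ hC0).1 hr4.2
  have hr5 : r * (ε * D) ≤ 1 := ((lt_div_iff₀ (by positivity)).1 hr5.2).le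
  apply hconv _ _ hr
  set B := ε * D * r ^ 2
  have hB : 0 ≤ B := by positivity
  have hBr : B ≤ r := by
    calc B = (r * (ε * D)) * r := by simp only [B]; ring
      _ ≤ 1 * r := by gcongr
      _ = r := one_mul r
  set Y : Set (𝔼 (k+1)) := {y | ‖y - 0‖ ≤ A * r ∧ |inner ℝ v (y - 0)| ≤ B}
  have hYball : Y ⊆ ball 0 ρ₂ := by
    intro y hy
    rw [mem_ball, dist_eq_norm]
    exact hy.1.trans_lt (by linarith [mul_comm A r])
  have hsub : f '' closedBall x r ⊆
      (fun y => f x + y + (inner ℝ v (f (x + s y) - f x) : ℝ) • v) '' Y := by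
    rintro _ ⟨y, hy, rfl⟩
    obtain ⟨b1, b2, b3⟩ := Hb r hr hr1.2 y hy
    set w := f y - f x
    have hyx : ‖y - x‖ ≤ r := by simpa [dist_eq_norm] using hy
    set τ : ℝ := inner ℝ v (f (x + s w) - f x)
    -- key estimate
    have key : |inner ℝ v w - τ| ≤ B := by
      set a := x + s (P (y - x))
      have hs1 : ‖s (P (y - x))‖ ≤ ‖s‖ * L * r := by
        calc ‖s (P (y - x))‖ ≤ ‖s‖ * ‖P (y - x)‖ := s.le_opNorm _
          _ ≤ ‖s‖ * (‖P‖ * ‖y - x‖) := by gcongr; exact P.le_opNorm _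
          _ ≤ ‖s‖ * (L * r) := by
              gcongr
              simp only [L]; linarith
          _ = _ := by ring
      have hs2 : ‖s w‖ ≤ ‖s‖ * L * r := by
        calc ‖s w‖ ≤ ‖s‖ * ‖w‖ := s.le_opNorm _
          _ ≤ ‖s‖ * (L * r) := by gcongr
          _ = _ := by ring
      have hC0r : r * C0 = r + ‖s‖ * L * r := by simp only [C0]; ring
      have hnn : 0 ≤ ‖s‖ * L * r := by positivity
      have ha : a ∈ closedBall x (r * C0) := by
        rw [mem_closedBall, dist_eq_norm]; simp only [a, add_sub_cancel_left]; linarith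
      have hy' : y ∈ closedBall x (r * C0) := by
        rw [mem_closedBall, dist_eq_norm]; linarith
      have hw' : x + s w ∈ closedBall x (r * C0) := by
        rw [mem_closedBall, dist_eq_norm]; simp only [add_sub_cancel_left]; linarith
      have hker : P (y - a) = 0 := by
        have : y - a = (y - x) - s (P (y - x)) := by simp only [a]; abel
        rw [this, map_sub, hs, hvP]; simp
      have e1 := Hk _ hr3 a ha y hy' hker
      have hya : ‖y - a‖ ≤ 2 * (r * C0) := by
        have : y - a = (y - x) - s (P (y - x)) := by simp only [a]; abel
        rw [this]
        refine (norm_sub_le _ _).trans ?_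
        linarith
      have e1' : |inner ℝ v (f y - f a)| ≤ ε * (2 * C0 ^ 2) * r ^ 2 := by
        refine e1.trans ?_
        calc ε * (r * C0) * ‖y - a‖ ≤ ε * (r * C0) * (2 * (r * C0)) := by gcongr
          _ = _ := by ring
      have hball : ∀ z ∈ closedBall x (r * C0), z ∈ t := fun z hz =>
        hρt (closedBall_subset_ball hr4 hz)
      have e2 := hap a (hball a ha) (x + s w) (hball _ hw')
      have e2' : |inner ℝ v (f a - f (x + s w))| ≤ ε * (‖s‖ * M) * r ^ 2 := by
        have h3 : ‖a - (x + s w)‖ ≤ ‖s‖ * (M * r ^ 2) := by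
          have : a - (x + s w) = s (-(w - P (y - x))) := by
            simp only [a, map_neg, map_sub]; abel
          rw [this]
          refine (s.le_opNorm _).trans ?_
          rw [norm_neg]
          gcongr
        rw [inner_sub_right, ← Real.norm_eq_abs]
        have e3 : ‖inner ℝ v (f a) - inner ℝ v (f (x + s w))‖ ≤ ε * ‖a - (x + s w)‖ := by
          rw [show (0 : (𝔼 (k+2)) →L[ℝ] ℝ) (a - (x + s w)) = 0 from rfl, sub_zero] at e2
          exact e2
        refine e3.trans ?_
        calc ε * ‖a - (x + s w)‖ ≤ ε * (‖s‖ * (M * r ^ 2)) := by gcongr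
          _ = _ := by ring
      have e3 : inner ℝ v w - τ = inner ℝ v (f y - f a) + inner ℝ v (f a - f (x + s w)) := by
        simp only [w, τ, inner_sub_right]; ring
      rw [e3]
      refine (abs_add_le _ _).trans ?_
      calc _ ≤ ε * (2 * C0 ^ 2) * r ^ 2 + ε * (‖s‖ * M) * r ^ 2 := add_le_add e1' e2'
        _ = B := by simp only [B, D]; ring
    have hin : inner ℝ v (w - τ • v) = inner ℝ v w - τ := by
      rw [inner_sub_right, inner_smul_right, hvv, mul_one]
    refine ⟨w - τ • v, ⟨?_, ?_⟩, ?_⟩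
    · rw [sub_zero]
      have h1 : |inner ℝ v w| ≤ L * r := by
        refine (abs_real_inner_le_norm _ _).trans ?_
        rw [hv, one_mul]; exact b2
      have h2 : |τ| ≤ L * r + r := by
        have := abs_sub_abs_le_abs_sub τ (inner ℝ v w)
        rw [abs_sub_comm] at this
        linarith
      have h3 : ‖τ • v‖ = |τ| := by rw [norm_smul, hv, mul_one, Real.norm_eq_abs]
      have h4 := norm_sub_le w (τ • v)
      rw [h3] at h4
      calc _ ≤ _ := h4
        _ ≤ L * r + (L * r + r) := add_le_add b2 h2
        _ = A * r := by simp only [A]; ring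
    · rw [sub_zero, hin]; exact key
    · have : s (w - τ • v) = s w := by simp [hsv]
      simp only [this]
      show f x + (w - τ • v) + τ • v = f y
      simp only [w]; abel
  calc volume (f '' closedBall x r) ≤ _ := measure_mono hsub
    _ ≤ 2 * volume Y := Hs Y hYball
    _ ≤ 2 * ENNReal.ofReal (2 ^ (k+1) * (A * r) ^ k * B) := by
        gcongr
        exact psard_box1 v hv Y 0 (A * r) B (by positivity) hB (fun y hy => hy)
    _ = ENNReal.ofReal (2 * (2 ^ (k+1) * (A * r) ^ k * B)) := by
        rw [ENNReal.ofReal_mul (by norm_num : (0:ℝ) ≤ 2), ENNReal.ofReal_ofNat]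
    _ = _ := by
        congr 1
        have : ε * (2 ^ (k+2) * A ^ k * D) = δ * c := div_mul_cancel₀ _ (by positivity)
        rw [← this]; simp only [B]; ring

lemma psard_sard {k : ℕ} (f : (𝔼 (k+2)) → (𝔼 (k+1))) (C : Set (𝔼 (k+2)))
    (hf : ∀ x ∈ C, ContDiffAt ℝ 2 f x)
    (hC : ∀ y ∈ C, ¬ Function.Surjective (fderiv ℝ f y)) : volume (f '' C) = 0 := by
  set G := {x | Tendsto (fun r => volume (C ∩ closedBall x r) / volume (closedBall x r))
    (𝓝[>] 0) (𝓝 1)}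
  have hG : volume (Gᶜ ∩ C) = 0 := by
    have := Besicovitch.ae_tendsto_measure_inter_div (volume : Measure (𝔼 (k+2))) C
    have h2 : (volume.restrict C) Gᶜ = 0 := this
    exact le_antisymm ((Measure.le_restrict_apply _ _).trans h2.le) (zero_le)
  have hgood : ∀ n : ℕ, volume (f '' (C ∩ G ∩ ball 0 n)) = 0 := by
    intro n
    have hb : ∀ δ : NNReal, 0 < δ →
        volume (f '' (C ∩ G ∩ ball 0 n)) ≤ δ * volume (C ∩ G ∩ ball 0 n) := by
      intro δ hδ
      apply psard_cover
      rintro x ⟨⟨hxC, hxG⟩, -⟩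
      obtain ⟨v, hv, hvP⟩ := psard_normal _ (hC x hxC)
      rcases psard_normal2 _ v hv hvP with ⟨w, hw, hvw, hwP⟩ | hR
      · exact psard_good1 f x (hf x hxC) v w hv hw hvw hvP hwP δ hδ
      · exact psard_good2 f C x hC hxG (hf x hxC) v hv hvP hR δ hδ
    have hfin : volume (C ∩ G ∩ ball (0 : 𝔼 (k+2)) n) ≠ ⊤ :=
      ((measure_mono inter_subset_right).trans_lt measure_ball_lt_top).ne
    have hlim : Tendsto (fun δ : NNReal => (δ:ENNReal) * volume (C ∩ G ∩ ball (0 : 𝔼 (k+2)) n))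
        (𝓝[>] 0) (𝓝 ((0:NNReal) * volume (C ∩ G ∩ ball (0 : 𝔼 (k+2)) n))) := by
      refine ENNReal.Tendsto.mul_const ?_ (Or.inr hfin)
      exact ENNReal.tendsto_coe.2 (tendsto_id.mono_left nhdsWithin_le_nhds)
    have := ge_of_tendsto hlim (eventually_nhdsWithin_of_forall (fun ε hε => hb ε hε))
    simpa using this
  have hbad : ∀ n : ℕ, volume (f '' {x ∈ Gᶜ ∩ C | ∀ᶠ r in 𝓝[>] (0:ℝ),
      volume (f '' closedBall x r) ≤ (n : NNReal) * volume (closedBall x r)}) = 0 := by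
    intro n
    have := psard_cover f {x ∈ Gᶜ ∩ C | ∀ᶠ r in 𝓝[>] (0:ℝ),
      volume (f '' closedBall x r) ≤ (n : NNReal) * volume (closedBall x r)} n (fun x hx => hx.2)
    have h0 : volume {x ∈ Gᶜ ∩ C | ∀ᶠ r in 𝓝[>] (0:ℝ),
      volume (f '' closedBall x r) ≤ (n : NNReal) * volume (closedBall x r)} = 0 :=
      measure_mono_null (sep_subset _ _) hG
    rw [h0, mul_zero] at this
    exact le_antisymm this (zero_le)
  refine measure_mono_null ?_ (measure_union_null (measure_iUnion_null hgood)
    (measure_iUnion_null hbad))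
  rintro _ ⟨x, hx, rfl⟩
  by_cases hxG : x ∈ G
  · left
    obtain ⟨n, hn⟩ := exists_nat_gt ‖x‖
    exact mem_iUnion.2 ⟨n, x, ⟨⟨hx, hxG⟩, by simpa using hn⟩, rfl⟩
  · right
    obtain ⟨K, hK⟩ := psard_all f x (hf x hx) (hC x hx)
    obtain ⟨n, hn⟩ := exists_nat_ge K
    refine mem_iUnion.2 ⟨n, x, ⟨⟨hxG, hx⟩, ?_⟩, rfl⟩
    filter_upwards [hK] with r hr
    refine hr.trans ?_
    gcongr


lemma psard_chart {m n : ℕ} (A : ((𝔼 m) × ℝ × (𝔼 n)) →L[ℝ] (𝔼 n)) (hA : Function.Surjective A) :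
    ∃ (L : ((𝔼 m) × ℝ × (𝔼 n)) →L[ℝ] (𝔼 (m+1)))
      (e : ((𝔼 m) × ℝ × (𝔼 n)) ≃L[ℝ] (𝔼 n) × (𝔼 (m+1))),
      (e : ((𝔼 m) × ℝ × (𝔼 n)) →L[ℝ] (𝔼 n) × (𝔼 (m+1))) = A.prod L := by
  set K := A.toLinearMap.ker
  have hrk : Module.finrank ℝ K = m + 1 := by
    have h1 := A.toLinearMap.finrank_range_add_finrank_ker
    have h2 : Module.finrank ℝ ((𝔼 m) × ℝ × (𝔼 n)) = m + (1 + n) := by simp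
    rw [LinearMap.range_eq_top.2 hA, finrank_top, h2, finrank_euclideanSpace_fin] at h1
    change n + Module.finrank ℝ K = _ at h1
    omega
  have e0 : K ≃ₗ[ℝ] (𝔼 (m+1)) := LinearEquiv.ofFinrankEq _ _ (by rw [hrk]; simp)
  obtain ⟨π, hπ⟩ := K.subtype.exists_leftInverse_of_injective (Submodule.ker_subtype K)
  set L := LinearMap.toContinuousLinearMap (e0.toLinearMap ∘ₗ π)
  set T := (A.prod L).toLinearMap
  have hT : Function.Injective T := by
    rw [injective_iff_map_eq_zero]
    intro x hx
    have hx1 : A x = 0 := congrArg Prod.fst hx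
    have hx2 : e0 (π x) = 0 := congrArg Prod.snd hx
    have hx3 : π x = 0 := by simpa using hx2
    have := LinearMap.congr_fun hπ ⟨x, hx1⟩
    simp only [LinearMap.comp_apply, Submodule.subtype_apply, hx3, LinearMap.id_apply] at this
    exact (congrArg Subtype.val this).symm
  refine ⟨L, (LinearEquiv.ofInjectiveOfFinrankEq T hT (by simp; omega)).toContinuousLinearEquiv, ?_⟩
  exact ContinuousLinearMap.ext (fun x => rfl)

lemma psard_main {m n : ℕ}
    (ρ : (𝔼 m) × ℝ × (𝔼 n) → (𝔼 n)) (Z : Set ((𝔼 m) × ℝ × (𝔼 n)))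
    (hC2 : ∀ p ∈ Z, ContDiffAt ℝ 2 ρ p) (hZ : ∀ p ∈ Z, ρ p = 0)
    (hs : ∀ p ∈ Z, Function.Surjective (fderiv ℝ ρ p))
    (hbad : ∀ p ∈ Z, ¬ Function.Surjective
      ((fderiv ℝ ρ p) ∘L (ContinuousLinearMap.inr ℝ (𝔼 m) (ℝ × (𝔼 n))))) :
    volume (Prod.fst '' Z) = 0 := by
  rcases m with _ | m
  · -- no parameters
    have : Z = ∅ := by
      by_contra hne
      obtain ⟨p, hp⟩ := nonempty_iff_ne_empty.2 hne
      apply hbad p hp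
      intro w
      obtain ⟨⟨c, q⟩, h⟩ := hs p hp w
      refine ⟨q, ?_⟩
      rw [Subsingleton.elim c 0] at h
      simpa using h
    simp [this]
  set μ := OuterMeasure.comap (Prod.fst : (𝔼 (m+1)) × ℝ × (𝔼 n) → _)
    (volume : Measure (𝔼 (m+1))).toOuterMeasure
  have hμ : ∀ S, μ S = volume (Prod.fst '' S) := fun S => by simp [μ]
  rw [← hμ]
  refine measure_null_of_locally_null Z (fun p hp => ?_)
  obtain ⟨L, e, he⟩ := psard_chart (fderiv ℝ ρ p) (hs p hp)
  set Γ : (𝔼 (m+1)) × ℝ × (𝔼 n) → (𝔼 n) × (𝔼 (m+1+1)) := fun q => (ρ q, L q)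
  have hΓ : ContDiffAt ℝ 2 Γ p := (hC2 p hp).prodMk L.contDiff.contDiffAt
  have hΓ' : HasFDerivAt Γ (e : ((𝔼 (m+1)) × ℝ × (𝔼 n)) →L[ℝ] _) p := by
    rw [he]
    exact ((hC2 p hp).differentiableAt (by simp)).hasFDerivAt.prodMk L.hasFDerivAt
  set Φ := hΓ.toOpenPartialHomeomorph Γ hΓ' (by simp)
  have hΦ : ∀ q, Φ q = Γ q := fun q => rfl
  have hpS : p ∈ Φ.source := hΓ.mem_toOpenPartialHomeomorph_source hΓ' (by simp)
  have hsym : ContDiffAt ℝ 2 Φ.symm (Γ p) := hΓ.to_localInverse hΓ' (by simp)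
  have hev : ∀ᶠ q in 𝓝 p, ContDiffAt ℝ 2 Φ.symm (Γ q) :=
    hΓ.continuousAt.eventually (hsym.eventually (by simp))
  have hev2 : ∀ᶠ q in 𝓝 p, q ∈ Φ.source := Φ.open_source.mem_nhds hpS
  set W := {q | ContDiffAt ℝ 2 Φ.symm (Γ q) ∧ q ∈ Φ.source}
  refine ⟨W ∩ Z, inter_mem (mem_nhdsWithin_of_mem_nhds (hev.and hev2)) self_mem_nhdsWithin, ?_⟩
  rw [hμ]
  set Ψ : (𝔼 (m+2)) → (𝔼 (m+1)) × ℝ × (𝔼 n) := fun t => Φ.symm (0, t)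
  set f : (𝔼 (m+2)) → (𝔼 (m+1)) := fun t => (Ψ t).1
  have hΨL : ∀ q ∈ W ∩ Z, Ψ (L q) = q := by
    rintro q ⟨⟨-, hq⟩, hqZ⟩
    have := Φ.left_inv hq
    rw [hΦ] at this
    simpa [Ψ, Γ, hZ q hqZ] using this
  have hΨC : ∀ q ∈ W ∩ Z, ContDiffAt ℝ 2 Ψ (L q) := by
    rintro q ⟨⟨hq, -⟩, hqZ⟩
    have h1 : Γ q = (0, L q) := by simp [Γ, hZ q hqZ]
    rw [h1] at hq
    exact hq.comp (L q) (contDiff_prodMk_right (0 : 𝔼 n)).contDiffAt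
  have hfst : ∀ t, ContDiffAt ℝ 2 Ψ t → ContDiffAt ℝ 2 f t ∧
      fderiv ℝ f t = (ContinuousLinearMap.fst ℝ _ _) ∘L (fderiv ℝ Ψ t) := by
    intro t ht
    refine ⟨contDiffAt_fst.comp t ht, ?_⟩
    have hd : HasFDerivAt Ψ (fderiv ℝ Ψ t) t := (ht.differentiableAt (by simp)).hasFDerivAt
    exact (hasFDerivAt_fst.comp t hd).fderiv
  have key := psard_sard f (L '' (W ∩ Z)) ?_ ?_
  · refine measure_mono_null ?_ key
    rintro _ ⟨q, hq, rfl⟩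
    exact ⟨L q, ⟨q, hq, rfl⟩, by simp only [f, hΨL q hq]⟩
  · rintro _ ⟨q, hq, rfl⟩
    exact (hfst _ (hΨC q hq)).1
  · rintro _ ⟨q, hq, rfl⟩ hsurj
    apply hbad q hq.2
    rw [(hfst _ (hΨC q hq)).2] at hsurj
    have hd : HasFDerivAt Ψ (fderiv ℝ Ψ (L q)) (L q) :=
      ((hΨC q hq).differentiableAt (by simp)).hasFDerivAt
    -- `ρ ∘ Ψ = 0` near `L q`
    have hzero : (fderiv ℝ ρ q) ∘L (fderiv ℝ Ψ (L q)) = 0 := by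
      have hρ : HasFDerivAt ρ (fderiv ℝ ρ q) (Ψ (L q)) := by
        rw [hΨL q hq]
        exact ((hC2 q hq.2).differentiableAt (by simp)).hasFDerivAt
      have h1 : HasFDerivAt (fun t => ρ (Ψ t)) ((fderiv ℝ ρ q) ∘L (fderiv ℝ Ψ (L q))) (L q) :=
        hρ.comp (L q) hd
      have h2 : (fun t => ρ (Ψ t)) =ᶠ[𝓝 (L q)] fun _ => 0 := by
        have h3 : ((0 : 𝔼 n), L q) ∈ Φ.target := by
          have := Φ.map_source hq.1.2
          rw [hΦ] at this
          simpa [Γ, hZ q hq.2] using this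
        have hc : Continuous (fun t : 𝔼 (m+2) => ((0 : 𝔼 n), t)) := by fun_prop
        have h4 : ∀ᶠ t in 𝓝 (L q), ((0 : 𝔼 n), t) ∈ Φ.target :=
          hc.continuousAt (Φ.open_target.mem_nhds h3)
        filter_upwards [h4] with t ht
        have := Φ.right_inv ht
        rw [hΦ] at this
        exact congrArg Prod.fst this
      exact (h1.congr_of_eventuallyEq h2.symm).unique (hasFDerivAt_const 0 (L q))
    intro w
    obtain ⟨⟨c, u⟩, hcu⟩ := hs q hq.2 w
    obtain ⟨τ, hτ⟩ := hsurj c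
    have hτ : (fderiv ℝ Ψ (L q) τ).1 = c := hτ
    refine ⟨u - (fderiv ℝ Ψ (L q) τ).2, ?_⟩
    have h5 : (ContinuousLinearMap.inr ℝ (𝔼 (m+1)) (ℝ × (𝔼 n))) (u - (fderiv ℝ Ψ (L q) τ).2) =
        (c, u) - fderiv ℝ Ψ (L q) τ := by
      ext1
      · simp [hτ]
      · simp
    have h6 : fderiv ℝ ρ q (fderiv ℝ Ψ (L q) τ) = 0 :=
      congrArg (fun A : (𝔼 (m+2)) →L[ℝ] (𝔼 n) => A τ) hzero
    rw [ContinuousLinearMap.comp_apply, h5, map_sub, hcu, h6, sub_zero]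

end PSard

/-- **Parametrized Sard's Theorem** (Chow–Mallet-Paret–Yorke).
If `ρ : ℝ^m × ℝ × ℝⁿ → ℝⁿ` is C² on an open neighborhood of `U × [0,1) × V`
(`U`, `V` open) and is transversal to zero on `U × [0,1) × V`, then for
Lebesgue-almost every `c ∈ U` the map `ρ_c = ρ(c,·,·)` is transversal to zero
on `[0,1) × V`. -/
theorem parametrized_sard
    (m n : ℕ)
    (U : Set (EuclideanSpace ℝ (Fin m))) (V : Set (EuclideanSpace ℝ (Fin n)))
    (hU : IsOpen U) (hV : IsOpen V)
    (ρ : EuclideanSpace ℝ (Fin m) × ℝ × EuclideanSpace ℝ (Fin n) →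
      EuclideanSpace ℝ (Fin n))
    (N : Set (EuclideanSpace ℝ (Fin m) × ℝ × EuclideanSpace ℝ (Fin n)))
    (hN : IsOpen N)
    (hNsub : U ×ˢ (Set.Ico (0:ℝ) 1) ×ˢ V ⊆ N)
    (hC2 : ContDiffOn ℝ 2 ρ N)
    (htrans : ∀ c κ y, c ∈ U → κ ∈ Set.Ico (0:ℝ) 1 → y ∈ V →
      ρ (c, κ, y) = 0 → Function.Surjective (fderiv ℝ ρ (c, κ, y))) :
    ∀ᵐ c ∂(volume : Measure (EuclideanSpace ℝ (Fin m))), c ∈ U →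
      ∀ κ y, κ ∈ Set.Ico (0:ℝ) 1 → y ∈ V → ρ (c, κ, y) = 0 →
        Function.Surjective
          (fderiv ℝ (fun p : ℝ × EuclideanSpace ℝ (Fin n) => ρ (c, p.1, p.2))
            (κ, y)) := by
  set Z : Set (EuclideanSpace ℝ (Fin m) × ℝ × EuclideanSpace ℝ (Fin n)) :=
    {p | (p.1 ∈ U ∧ p.2.1 ∈ Set.Ico (0:ℝ) 1 ∧ p.2.2 ∈ V ∧ ρ p = 0) ∧ ¬ Function.Surjective
      ((fderiv ℝ ρ p) ∘L (ContinuousLinearMap.inr ℝ (EuclideanSpace ℝ (Fin m))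
        (ℝ × (EuclideanSpace ℝ (Fin n)))))}
  have hC2' : ∀ p : EuclideanSpace ℝ (Fin m) × ℝ × EuclideanSpace ℝ (Fin n),
      p.1 ∈ U → p.2.1 ∈ Set.Ico (0:ℝ) 1 → p.2.2 ∈ V → ContDiffAt ℝ 2 ρ p :=
    fun p h1 h2 h3 => hC2.contDiffAt (hN.mem_nhds (hNsub ⟨h1, h2, h3⟩))
  have hnull : volume (Prod.fst '' Z) = 0 := psard_main ρ Z
    (fun p hp => hC2' p hp.1.1 hp.1.2.1 hp.1.2.2.1) (fun p hp => hp.1.2.2.2)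
    (fun p hp => htrans p.1 p.2.1 p.2.2 hp.1.1 hp.1.2.1 hp.1.2.2.1 hp.1.2.2.2) (fun p hp => hp.2)
  have hae := measure_eq_zero_iff_ae_notMem.1 hnull
  filter_upwards [hae] with c hc hcU κ y hκ hy h0
  by_contra hns
  apply hc
  refine ⟨(c, κ, y), ⟨⟨hcU, hκ, hy, h0⟩, fun hs => hns ?_⟩, rfl⟩
  have hd : HasFDerivAt ρ (fderiv ℝ ρ (c, κ, y)) (c, κ, y) :=
    ((hC2' (c, κ, y) hcU hκ hy).differentiableAt (by simp)).hasFDerivAt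
  have hi : HasFDerivAt (fun p : ℝ × EuclideanSpace ℝ (Fin n) => (c, p))
      (ContinuousLinearMap.inr ℝ (EuclideanSpace ℝ (Fin m)) (ℝ × (EuclideanSpace ℝ (Fin n))))
      (κ, y) := hasFDerivAt_prodMk_right c (κ, y)
  have hcomp : HasFDerivAt (fun p : ℝ × EuclideanSpace ℝ (Fin n) => ρ (c, p.1, p.2))
      ((fderiv ℝ ρ (c, κ, y)) ∘L (ContinuousLinearMap.inr ℝ (EuclideanSpace ℝ (Fin m))
        (ℝ × (EuclideanSpace ℝ (Fin n))))) (κ, y) := hd.comp (κ, y) hi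
  rw [hcomp.fderiv]
  exact hs
end

section
/- Let α ≤ 0 and β ≥ 1 be real numbers, let U ⊆ ℝ^m and V ⊆ ℝⁿ be open sets, and let ρ : ℝ^m × ℝ × ℝⁿ → ℝⁿ be a map that is twice continuously differentiable on an open neighborhood of U × [α,β) × V. Suppose ρ is transversal to zero on U × [α,β) × V, i.e., for every (c,κ,y) ∈ U × [α,β) × V with ρ(c,κ,y) = 0, the Fréchet derivative of ρ at (c,κ,y), as a linear map from ℝ^m × ℝ × ℝⁿ to ℝⁿ, is surjective. Then for Lebesgue-almost every c ∈ U, the map ρ_c := ρ(c,·,·) is transversal to zero on [α,β) × V, i.e., for every (κ,y) ∈ [α,β) × V with ρ(c,κ,y) = 0, the Fréchet derivative of (κ,y) ↦ ρ(c,κ,y) at (κ,y), as a linear map from ℝ × ℝⁿ to ℝⁿ, is surjective. -/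
open MeasureTheory Set

theorem aux_locally_null {X Y : Type*} [TopologicalSpace X] [SecondCountableTopology X]
    [MeasurableSpace Y] (μ : Measure Y) (f : X → Y) (s : Set X)
    (h : ∀ x ∈ s, ∃ u ∈ nhds x, μ (f '' (s ∩ u)) = 0) : μ (f '' s) = 0 := by
  have := measure_null_of_locally_null (μ := OuterMeasure.comap f μ.toOuterMeasure) s ?_
  · simpa using this
  · intro x hx
    obtain ⟨u, hu, h0⟩ := h x hx
    exact ⟨s ∩ u, inter_mem_nhdsWithin s hu, by simpa using h0⟩

theorem aux_straighten {E R : Type*} [NormedAddCommGroup E] [NormedSpace ℝ E]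
    [FiniteDimensional ℝ E] [NormedAddCommGroup R] [NormedSpace ℝ R] [FiniteDimensional ℝ R]
    (k : ℕ) (hk : Module.finrank ℝ E = Module.finrank ℝ R + k)
    (j : ℕ) (hj : j ≠ 0) (h : E → R) (O : Set E) (hO : IsOpen O)
    (hh : ContDiffOn ℝ j h O) (a : E) (ha : a ∈ O)
    (hs : Function.Surjective (fderiv ℝ h a)) :
    ∃ (T : Set (R × (Fin k → ℝ))) (ψ : R × (Fin k → ℝ) → E), IsOpen T ∧
      ContDiffOn ℝ j ψ T ∧ (∀ t ∈ T, ψ t ∈ O ∧ h (ψ t) = t.1) ∧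
      ∀ᶠ x in nhds a, ∃ u, (h x, u) ∈ T ∧ ψ (h x, u) = x := by
  have : CompleteSpace E := FiniteDimensional.complete ℝ E
  set A := fderiv ℝ h a with hA
  set K := LinearMap.ker (A : E →ₗ[ℝ] R) with hK
  have hr : Module.finrank ℝ K = Module.finrank ℝ (Fin k → ℝ) := by
    have h1 := LinearMap.finrank_range_add_finrank_ker (A : E →ₗ[ℝ] R)
    have h2 : LinearMap.range (A : E →ₗ[ℝ] R) = ⊤ := LinearMap.range_eq_top.2 hs
    rw [h2, finrank_top] at h1
    simp only [Module.finrank_fin_fun]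
    change Module.finrank ℝ R + Module.finrank ℝ K = _ at h1
    omega
  let e0 : K ≃ₗ[ℝ] (Fin k → ℝ) := LinearEquiv.ofFinrankEq _ _ hr
  obtain ⟨Q, hQ⟩ := Submodule.exists_isCompl K
  let P0 : E →ₗ[ℝ] (Fin k → ℝ) := e0.toLinearMap ∘ₗ Submodule.projectionOnto K Q hQ
  let P : E →L[ℝ] (Fin k → ℝ) := LinearMap.toContinuousLinearMap P0
  have hP : ∀ x : E, A x = 0 → P x = 0 → x = 0 := by
    intro x h1 h2
    have hxK : x ∈ K := h1
    have : Submodule.projectionOnto K Q hQ x = ⟨x, hxK⟩ :=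
      Submodule.projectionOnto_apply_left hQ ⟨x, hxK⟩
    have h3 : e0 (Submodule.projectionOnto K Q hQ x) = 0 := h2
    rw [this] at h3
    have := (LinearEquiv.map_eq_zero_iff e0).1 h3
    simpa using congrArg Subtype.val this
  let L : E →L[ℝ] R × (Fin k → ℝ) := A.prod P
  have hLinj : Function.Injective (L : E →ₗ[ℝ] R × (Fin k → ℝ)) := by
    rw [← LinearMap.ker_eq_bot, LinearMap.ker_eq_bot']
    intro x hx
    have hx' : (A x, P x) = 0 := hx
    exact hP x (congrArg Prod.fst hx') (congrArg Prod.snd hx')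
  have hfr : Module.finrank ℝ E = Module.finrank ℝ (R × (Fin k → ℝ)) := by
    simp [hk]
  let e : E ≃L[ℝ] R × (Fin k → ℝ) :=
    (LinearMap.linearEquivOfInjective (L : E →ₗ[ℝ] R × (Fin k → ℝ)) hLinj hfr).toContinuousLinearEquiv
  have heL : (e : E →L[ℝ] R × (Fin k → ℝ)) = L := by
    ext x <;> rfl
  let Φ : E → R × (Fin k → ℝ) := fun x => (h x, P x)
  have hhat : ContDiffAt ℝ j h a := hh.contDiffAt (hO.mem_nhds ha)
  have hΦ : ContDiffAt ℝ j Φ a := hhat.prodMk P.contDiff.contDiffAt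
  have hj' : (j : WithTop ℕ∞) ≠ 0 := by exact_mod_cast hj
  have hd : HasFDerivAt Φ (e : E →L[ℝ] R × (Fin k → ℝ)) a := by
    rw [heL]
    exact (hhat.differentiableAt hj').hasFDerivAt.prodMk P.hasFDerivAt
  have hstrict : HasStrictFDerivAt Φ (e : E →L[ℝ] R × (Fin k → ℝ)) a :=
    hΦ.hasStrictFDerivAt' hd hj'
  let ψ := hΦ.localInverse hd hj'
  have hψ : ContDiffAt ℝ j ψ (Φ a) := hΦ.to_localInverse hd hj'
  have hψa : ψ (Φ a) = a := hΦ.localInverse_apply_image hd hj'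
  have h1 : ∀ᶠ t in nhds (Φ a), Φ (ψ t) = t := hstrict.eventually_right_inverse
  have h2 : ∀ᶠ x in nhds a, ψ (Φ x) = x := hstrict.eventually_left_inverse
  have h3 : ∀ᶠ t in nhds (Φ a), ContDiffAt ℝ j ψ t := hψ.eventually (by simp)
  have h4 : ∀ᶠ t in nhds (Φ a), ψ t ∈ O :=
    hψ.continuousAt.eventually_mem (by rw [hψa]; exact hO.mem_nhds ha)
  have h5 := h1.and (h3.and h4)
  obtain ⟨T, hT, hTo, haT⟩ := eventually_nhds_iff.1 h5
  refine ⟨T, ψ, hTo, fun t ht => (hT t ht).2.1.contDiffWithinAt, fun t ht => ⟨(hT t ht).2.2, ?_⟩, ?_⟩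
  · exact congrArg Prod.fst (hT t ht).1
  · have h6 : ∀ᶠ x in nhds a, Φ x ∈ T := hΦ.continuousAt.eventually_mem (hTo.mem_nhds haT)
    filter_upwards [h2, h6] with x hx hx'
    exact ⟨P x, hx', hx⟩

theorem aux_holder {E F : Type*} [NormedAddCommGroup E] [NormedSpace ℝ E]
    [NormedAddCommGroup F] [NormedSpace ℝ F]
    (g : E → F) (O : Set E) (hO : IsOpen O) (hg : ContDiffOn ℝ 2 g O)
    (x : E) (hx : x ∈ O) (hx2 : fderiv ℝ (fderiv ℝ g) x = 0) (ε : NNReal) (hε : 0 < ε) :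
    ∃ u, IsOpen u ∧ x ∈ u ∧ HolderOnWith ε 2 g ({z | z ∈ O ∧ fderiv ℝ g z = 0} ∩ u) := by
  have hg1 : ContDiffOn ℝ 1 (fderiv ℝ g) O := hg.fderiv_of_isOpen hO (by norm_num)
  have hg2 : ContinuousOn (fderiv ℝ (fderiv ℝ g)) O :=
    hg1.continuousOn_fderiv_of_isOpen hO le_rfl
  have h1 : ∀ᶠ z in nhds x, ‖fderiv ℝ (fderiv ℝ g) z‖ < ε := by
    have : ContinuousAt (fun z => ‖fderiv ℝ (fderiv ℝ g) z‖) x :=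
      ContinuousAt.norm (E := E →L[ℝ] E →L[ℝ] F) (f := fderiv ℝ (fderiv ℝ g)) (hg2.continuousAt (hO.mem_nhds hx))
    apply this.tendsto.eventually_lt_const
    rw [hx2]
    exact (norm_zero (E := E →L[ℝ] E →L[ℝ] F)).trans_lt (by exact_mod_cast hε)
  obtain ⟨r, hr, hb⟩ := Metric.eventually_nhds_iff_ball.1 (h1.and (hO.mem_nhds hx))
  refine ⟨Metric.ball x r, Metric.isOpen_ball, Metric.mem_ball_self hr, ?_⟩
  rintro y ⟨⟨hyO, hy0⟩, hyb⟩ z ⟨_, hzb⟩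
  have hd1 : ∀ w ∈ Metric.ball x r, ‖fderiv ℝ g w‖ ≤ ε * ‖w - y‖ := by
    intro w hw
    have := (convex_ball x r).norm_image_sub_le_of_norm_hasFDerivWithin_le
      (f := fderiv ℝ g) (f' := fderiv ℝ (fderiv ℝ g)) (C := ε)
      (fun v hv => (((hg1.contDiffAt (hO.mem_nhds (hb v hv).2)).differentiableAt
        (by norm_num)).hasFDerivAt.hasFDerivWithinAt)) (fun v hv => (hb v hv).1.le) hyb hw
    simpa [hy0] using this
  have hseg : segment ℝ y z ⊆ Metric.ball x r := (convex_ball x r).segment_subset hyb hzb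
  have h3 : ‖g z - g y‖ ≤ (ε * ‖z - y‖) * ‖z - y‖ := by
    refine (convex_segment y z).norm_image_sub_le_of_norm_hasFDerivWithin_le
      (f := g) (f' := fderiv ℝ g)
      (fun v hv => (((hg.contDiffAt (hO.mem_nhds (hb v (hseg hv)).2)).differentiableAt
        (by norm_num)).hasFDerivAt.hasFDerivWithinAt)) (fun v hv => ?_)
        (left_mem_segment ℝ y z) (right_mem_segment ℝ y z)
    refine (hd1 v (hseg hv)).trans ?_
    gcongr
    exact norm_sub_le_of_mem_segment hv
  rw [edist_comm, edist_comm y z, edist_eq_enorm_sub, edist_eq_enorm_sub]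
  have : ‖g z - g y‖₊ ≤ ε * ‖z - y‖₊ ^ 2 := by
    rw [← NNReal.coe_le_coe]; push_cast; linarith [h3, sq ‖z - y‖, mul_assoc (ε:ℝ) ‖z-y‖ ‖z-y‖]
  simp only [enorm_eq_nnnorm]
  have h2 : ((2 : NNReal) : ℝ) = ((2 : ℕ) : ℝ) := by norm_num
  rw [h2, ENNReal.rpow_natCast]
  exact_mod_cast this

theorem aux_flat {k : ℕ} (hk : 1 ≤ k) (g : (Fin (k+1) → ℝ) → (Fin k → ℝ))
    (O : Set (Fin (k+1) → ℝ)) (hO : IsOpen O) (hg : ContDiffOn ℝ 2 g O) :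
    volume (g '' {x | (x ∈ O ∧ fderiv ℝ g x = 0) ∧ fderiv ℝ (fderiv ℝ g) x = 0}) = 0 := by
  set Z := {x | (x ∈ O ∧ fderiv ℝ g x = 0) ∧ fderiv ℝ (fderiv ℝ g) x = 0} with hZ
  apply aux_locally_null
  intro x0 _
  refine ⟨Metric.ball x0 1, Metric.ball_mem_nhds _ one_pos, ?_⟩
  have key : ∀ ε : NNReal, 0 < ε →
      volume (g '' (Z ∩ Metric.ball x0 1)) ≤ (ε : ENNReal) ^ k * volume (Metric.ball x0 1) := by
    intro ε hε
    have hloc : ∀ x : Z, ∃ u, IsOpen u ∧ (x : Fin (k+1) → ℝ) ∈ u ∧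
        HolderOnWith ε 2 g ({z | z ∈ O ∧ fderiv ℝ g z = 0} ∩ u) := by
      rintro ⟨x, hx⟩
      exact aux_holder g O hO hg x hx.1.1 hx.2 ε hε
    choose u huo hux huh using hloc
    by_cases hne : Nonempty Z
    swap
    · have : Z = ∅ := Set.eq_empty_of_forall_notMem (by simpa using hne)
      simp [this]
    obtain ⟨t, ht, hcov⟩ := TopologicalSpace.isOpen_iUnion_countable u huo
    have htne : t.Nonempty := by
      by_contra h
      rw [Set.not_nonempty_iff_eq_empty] at h
      obtain ⟨z⟩ := hne
      have : (z : Fin (k+1) → ℝ) ∈ ⋃ i ∈ t, u i := by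
        rw [hcov]; exact Set.mem_iUnion.2 ⟨z, hux z⟩
      simp [h] at this
    obtain ⟨q, hq⟩ := ht.exists_eq_range htne
    let B : ℕ → Set (Fin (k+1) → ℝ) := fun i => u (q i)
    have hBcov : Z ⊆ ⋃ i, B i := by
      intro z hz
      have : z ∈ ⋃ i ∈ t, u i := by
        rw [hcov]; exact Set.mem_iUnion.2 ⟨⟨z, hz⟩, hux _⟩
      rw [hq] at this
      simpa [B] using this
    have hbound : ∀ s i, s ⊆ Z ∩ B i → volume (g '' s) ≤ (ε : ENNReal) ^ k * volume s := by
      intro s i hs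
      have hh : HolderOnWith ε 2 g s := (huh (q i)).mono
        (fun z hz => ⟨(hs hz).1.1, (hs hz).2⟩)
      have h1 := hh.hausdorffMeasure_image_le (by norm_num) (d := k) (by positivity)
      have e1 : (volume : Measure (Fin k → ℝ)) = Measure.hausdorffMeasure (k : ℝ) := by
        rw [← hausdorffMeasure_pi_real]; simp
      have e2 : (volume : Measure (Fin (k+1) → ℝ)) = Measure.hausdorffMeasure ((k : ℝ) + 1) := by
        rw [← hausdorffMeasure_pi_real]; simp
      rw [e1, e2]
      refine h1.trans ?_
      rw [ENNReal.rpow_natCast]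
      gcongr
      apply Measure.hausdorffMeasure_mono
      have : (1 : ℝ) ≤ k := by exact_mod_cast hk
      push_cast
      linarith
    let D := disjointed B
    have hD : ∀ i, MeasurableSet (D i) := fun i =>
      MeasurableSet.disjointed (fun i => (huo (q i)).measurableSet) i
    have hsub : g '' (Z ∩ Metric.ball x0 1) ⊆ ⋃ i, g '' (Z ∩ Metric.ball x0 1 ∩ D i) := by
      rw [← Set.image_iUnion]
      apply Set.image_mono
      intro z hz
      rw [← Set.inter_iUnion]
      refine ⟨hz, ?_⟩
      rw [iUnion_disjointed]
      exact hBcov hz.1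
    calc volume (g '' (Z ∩ Metric.ball x0 1))
        ≤ ∑' i, volume (g '' (Z ∩ Metric.ball x0 1 ∩ D i)) :=
          (measure_mono hsub).trans (measure_iUnion_le _)
      _ ≤ ∑' i, (ε : ENNReal) ^ k * volume (Metric.ball x0 1 ∩ D i) := by
          refine ENNReal.tsum_le_tsum fun i => ?_
          refine (hbound _ i ?_).trans ?_
          · rintro z ⟨hz, hzD⟩
            exact ⟨hz.1, disjointed_subset B i hzD⟩
          · gcongr
            exact Set.inter_subset_right
      _ = (ε : ENNReal) ^ k * ∑' i, volume (Metric.ball x0 1 ∩ D i) := ENNReal.tsum_mul_left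
      _ ≤ (ε : ENNReal) ^ k * volume (Metric.ball x0 1) := by
          gcongr
          rw [← measure_iUnion]
          · exact measure_mono (Set.iUnion_subset fun i => Set.inter_subset_left)
          · intro i j hij
            exact ((disjoint_disjointed B) hij).mono Set.inter_subset_right Set.inter_subset_right
          · exact fun i => measurableSet_ball.inter (hD i)
  have hfin : volume (Metric.ball x0 1) ≠ ⊤ := measure_ball_lt_top.ne
  have hlim : Filter.Tendsto (fun ε : NNReal => (ε : ENNReal) ^ k * volume (Metric.ball x0 1))
      (nhdsWithin 0 (Set.Ioi 0)) (nhds 0) := by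
    have h1 : Filter.Tendsto (fun ε : NNReal => (ε : ENNReal) ^ k) (nhds 0) (nhds 0) := by
      have : Continuous (fun ε : NNReal => (ε : ENNReal) ^ k) := by
        have : Continuous (fun ε : NNReal => ((ε ^ k : NNReal) : ENNReal)) := by fun_prop
        simpa using this
      have h := this.tendsto 0
      simpa [show k ≠ 0 by omega] using h
    have h2 := ENNReal.Tendsto.mul_const (b := volume (Metric.ball x0 1)) h1 (Or.inr hfin)
    simpa using h2.mono_left nhdsWithin_le_nhds
  refine le_antisymm (ge_of_tendsto hlim ?_) zero_le
  filter_upwards [self_mem_nhdsWithin] with ε hε using key ε hε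

theorem aux_zero_deriv {k : ℕ} (hk : 1 ≤ k) (g : (Fin (k+1) → ℝ) → (Fin k → ℝ))
    (O : Set (Fin (k+1) → ℝ)) (hO : IsOpen O) (hg : ContDiffOn ℝ 2 g O) :
    volume (g '' {x | x ∈ O ∧ fderiv ℝ g x = 0}) = 0 := by
  set Z := {x | x ∈ O ∧ fderiv ℝ g x = 0} with hZ
  have hsplit : Z = {x | (x ∈ O ∧ fderiv ℝ g x = 0) ∧ fderiv ℝ (fderiv ℝ g) x = 0} ∪
      {x | (x ∈ O ∧ fderiv ℝ g x = 0) ∧ fderiv ℝ (fderiv ℝ g) x ≠ 0} := by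
    ext x; simp only [hZ, Set.mem_ofPred_eq, Set.mem_union]; tauto
  rw [hsplit, Set.image_union]
  refine measure_union_null (aux_flat hk g O hO hg) ?_
  apply aux_locally_null
  rintro a ⟨⟨haO, ha1⟩, ha2⟩
  have hg1 : ContDiffOn ℝ 1 (fderiv ℝ g) O := hg.fderiv_of_isOpen hO (by norm_num)
  have hex : ∃ v0 v i, fderiv ℝ (fderiv ℝ g) a v0 v i ≠ 0 := by
    by_contra! h
    apply ha2
    ext1 v0
    ext1 v
    funext i
    exact h v0 v i
  obtain ⟨v0, v, i, hv⟩ := hex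
  let ℓ : ((Fin (k+1) → ℝ) →L[ℝ] (Fin k → ℝ)) →L[ℝ] ℝ :=
    (ContinuousLinearMap.proj i : (Fin k → ℝ) →L[ℝ] ℝ).comp
      (ContinuousLinearMap.apply ℝ (Fin k → ℝ) v)
  let w : (Fin (k+1) → ℝ) → ℝ := fun x => ℓ (fderiv ℝ g x)
  have hw : ContDiffOn ℝ (1 : ℕ) w O := by
    exact_mod_cast ℓ.contDiff.comp_contDiffOn hg1
  have hdw : fderiv ℝ w a = ℓ.comp (fderiv ℝ (fderiv ℝ g) a) :=
    (ℓ.hasFDerivAt.comp a ((hg1.contDiffAt (hO.mem_nhds haO)).differentiableAt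
        (by norm_num)).hasFDerivAt).fderiv
  have hsurj : Function.Surjective (fderiv ℝ w a) := by
    apply LinearMap.surjective (f := (fderiv ℝ w a : (Fin (k+1) → ℝ) →ₗ[ℝ] ℝ))
    intro h0
    have : fderiv ℝ w a v0 = 0 := congrArg (fun f : (Fin (k+1) → ℝ) →ₗ[ℝ] ℝ => f v0) h0
    rw [hdw] at this
    exact hv this
  obtain ⟨T, ψ, hT, hψ, hTO, hev⟩ := aux_straighten k (by simp [add_comm]) 1 one_ne_zero w O hO hw a haO hsurj
  refine ⟨_, hev, ?_⟩
  let T0 : Set (Fin k → ℝ) := {u | ((0 : ℝ), u) ∈ T}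
  let f : (Fin k → ℝ) → (Fin k → ℝ) := fun u => g (ψ (0, u))
  let f' : (Fin k → ℝ) → (Fin k → ℝ) →L[ℝ] (Fin k → ℝ) := fun u => 0
  let C : Set (Fin k → ℝ) := {u | (0, u) ∈ T ∧ fderiv ℝ g (ψ (0, u)) = 0}
  have hnull : volume (f '' C) = 0 := by
    refine addHaar_image_eq_zero_of_det_fderivWithin_eq_zero volume (f := f) (f' := f') ?_ ?_
    · rintro u ⟨huT, hu0⟩
      have hd1 : HasFDerivAt ψ (fderiv ℝ ψ (0, u)) (0, u) :=
        ((hψ.contDiffAt (hT.mem_nhds huT)).differentiableAt (by norm_num)).hasFDerivAt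
      have hd2 : HasFDerivAt g (0 : (Fin (k+1) → ℝ) →L[ℝ] (Fin k → ℝ)) (ψ (0, u)) := by
        rw [← hu0]
        exact ((hg.contDiffAt (hO.mem_nhds (hTO _ huT).1)).differentiableAt
          (by norm_num)).hasFDerivAt
      have hd3 := (hd2.comp (0, u) hd1).comp u (hasFDerivAt_prodMk_right (0:ℝ) u)
      simp only [ContinuousLinearMap.zero_comp] at hd3
      exact hd3.hasFDerivWithinAt
    · intro u _
      have : Nonempty (Fin k) := ⟨⟨0, hk⟩⟩
      simp [f', ContinuousLinearMap.det]
  refine measure_mono_null ?_ hnull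
  rintro _ ⟨x, ⟨⟨⟨hxO, hx1⟩, hx2⟩, u, huT, hux⟩, rfl⟩
  have hw0 : w x = 0 := by simp only [w, hx1, map_zero]
  rw [hw0] at huT hux
  exact ⟨u, ⟨huT, by rw [hux]; exact hx1⟩, by simp only [f, hux]⟩

theorem aux_lin {r s : ℕ} (W : Submodule ℝ ((Fin r → ℝ) × (Fin s → ℝ)))
    (hW : Module.finrank ℝ W = r) (hs : ∀ t, ∃ w ∈ W, w.1 = t) :
    ∀ w ∈ W, w.1 = 0 → w = 0 := by
  let q : W →ₗ[ℝ] (Fin r → ℝ) := (LinearMap.fst ℝ _ _).comp W.subtype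
  have hq : Function.Surjective q := fun t => by
    obtain ⟨w, hw, h⟩ := hs t
    exact ⟨⟨w, hw⟩, h⟩
  have hi : Function.Injective q :=
    (LinearMap.injective_iff_surjective_of_finrank_eq_finrank (by simp [hW])).2 hq
  intro w hw h0
  have : (⟨w, hw⟩ : W) = 0 := hi (by simpa [q] using h0)
  exact congrArg Subtype.val this

theorem aux_split {F : Type*} [NormedAddCommGroup F] [NormedSpace ℝ F] [FiniteDimensional ℝ F]
    (R : Submodule ℝ F) (r s : ℕ) (hr : Module.finrank ℝ R = r)
    (hs : Module.finrank ℝ F = r + s) :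
    ∃ e : F ≃L[ℝ] (Fin r → ℝ) × (Fin s → ℝ), ∀ t, ∃ w ∈ R, (e w).1 = t := by
  obtain ⟨S, hS⟩ := Submodule.exists_isCompl R
  have hS' : Module.finrank ℝ S = s := by
    have := Submodule.finrank_add_eq_of_isCompl hS
    omega
  let e1 : R ≃ₗ[ℝ] (Fin r → ℝ) := LinearEquiv.ofFinrankEq _ _ (by simp [hr])
  let e2 : S ≃ₗ[ℝ] (Fin s → ℝ) := LinearEquiv.ofFinrankEq _ _ (by simp [hS'])
  let e := (Submodule.prodEquivOfIsCompl R S hS).symm.trans (e1.prodCongr e2)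
  refine ⟨e.toContinuousLinearEquiv, fun t => ⟨e1.symm t, (e1.symm t).2, ?_⟩⟩
  change (e (e1.symm t)).1 = t
  simp [e]

theorem aux_sard {E F : Type*} [NormedAddCommGroup E] [NormedSpace ℝ E] [FiniteDimensional ℝ E]
    [NormedAddCommGroup F] [NormedSpace ℝ F] [FiniteDimensional ℝ F]
    [MeasurableSpace F] [BorelSpace F] (μ : Measure F) [μ.IsAddHaarMeasure]
    (hEF : Module.finrank ℝ E = Module.finrank ℝ F + 1)
    (f : E → F) (O : Set E) (hO : IsOpen O) (hf : ContDiffOn ℝ 2 f O) :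
    μ (f '' {x | x ∈ O ∧ ¬ Function.Surjective (fderiv ℝ f x)}) = 0 := by
  have : CompleteSpace E := FiniteDimensional.complete ℝ E
  have : SecondCountableTopology E := by
    have : ProperSpace E := FiniteDimensional.proper ℝ E
    infer_instance
  have hsplit : {x | x ∈ O ∧ ¬ Function.Surjective (fderiv ℝ f x)} =
      ⋃ r : ℕ, {x | (x ∈ O ∧ ¬ Function.Surjective (fderiv ℝ f x)) ∧
        Module.finrank ℝ (LinearMap.range (fderiv ℝ f x : E →ₗ[ℝ] F)) = r} := by
    ext x; simp
  rw [hsplit, Set.image_iUnion]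
  refine measure_iUnion_null fun r => ?_
  apply aux_locally_null
  rintro a ⟨⟨haO, hans⟩, har⟩
  have hlt : r < Module.finrank ℝ F := by
    rw [← har]
    apply Submodule.finrank_lt
    intro h
    exact hans (LinearMap.range_eq_top.1 h)
  obtain ⟨s, hs⟩ := Nat.exists_eq_add_of_lt hlt
  set S := s + 1 with hS
  obtain ⟨e, he⟩ := aux_split (LinearMap.range (fderiv ℝ f a : E →ₗ[ℝ] F)) r S har (by omega)
  let L : F →L[ℝ] (Fin r → ℝ) :=
    (ContinuousLinearMap.fst ℝ (Fin r → ℝ) (Fin S → ℝ)).comp (e : F →L[ℝ] _)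
  let h : E → (Fin r → ℝ) := fun x => L (f x)
  have hh : ContDiffOn ℝ (2 : ℕ) h O := by
    exact_mod_cast L.contDiff.comp_contDiffOn hf
  have hdf : ∀ x ∈ O, HasFDerivAt f (fderiv ℝ f x) x := fun x hx =>
    ((hf.contDiffAt (hO.mem_nhds hx)).differentiableAt (by norm_num)).hasFDerivAt
  have hdh : fderiv ℝ h a = L.comp (fderiv ℝ f a) := (L.hasFDerivAt.comp a (hdf a haO)).fderiv
  have hsurj : Function.Surjective (fderiv ℝ h a) := by
    intro t
    obtain ⟨_, ⟨v, rfl⟩, hv⟩ := he t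
    refine ⟨v, ?_⟩
    rw [hdh]
    exact hv
  obtain ⟨T, ψ, hT, hψ, hTO, hev⟩ := aux_straighten (S + 1)
    (by simp only [Module.finrank_fin_fun]; omega) 2 two_ne_zero h O hO hh a haO hsurj
  refine ⟨_, hev, ?_⟩
  let ft : (Fin r → ℝ) × (Fin (S+1) → ℝ) → (Fin r → ℝ) × (Fin S → ℝ) := fun p => e (f (ψ p))
  have hft : ContDiffOn ℝ 2 ft T := by
    have h1 : ContDiffOn ℝ 2 (fun p => f (ψ p)) T :=
      hf.comp (by exact_mod_cast hψ) (fun t ht => (hTO t ht).1)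
    exact e.contDiff.comp_contDiffOn h1
  have hft1 : ∀ p ∈ T, (ft p).1 = p.1 := fun p hp => (hTO p hp).2
  let G : (Fin r → ℝ) × (Fin (S+1) → ℝ) → (Fin S → ℝ) := fun p => (ft p).2
  have hG : ContDiffOn ℝ 2 G T := contDiff_snd.comp_contDiffOn hft
  let J : (Fin (S+1) → ℝ) →L[ℝ] (Fin r → ℝ) × (Fin (S+1) → ℝ) :=
    ContinuousLinearMap.inr ℝ (Fin r → ℝ) (Fin (S+1) → ℝ)
  let Gx := fun p => (fderiv ℝ G p).comp J
  have hGx : ContinuousOn Gx T :=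
    (hG.continuousOn_fderiv_of_isOpen hT (by norm_num)).clm_comp continuousOn_const
  let Z := {p | p ∈ T ∧ Gx p = 0}
  have hnull : volume (ft '' Z) = 0 := by
    apply aux_locally_null
    rintro p0 ⟨hp0, _⟩
    obtain ⟨δ, hδ, hball⟩ := Metric.nhds_basis_closedBall.mem_iff.1 (hT.mem_nhds hp0)
    refine ⟨Metric.closedBall p0 δ, Metric.closedBall_mem_nhds _ hδ, ?_⟩
    have hZc : Z ∩ Metric.closedBall p0 δ = Metric.closedBall p0 δ ∩ Gx ⁻¹' {0} := by
      ext p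
      constructor
      · rintro ⟨⟨_, h1⟩, h2⟩; exact ⟨h2, h1⟩
      · rintro ⟨h2, h1⟩; exact ⟨⟨hball h2, h1⟩, h2⟩
    have hcomp : IsCompact (Z ∩ Metric.closedBall p0 δ) := by
      rw [hZc]
      refine (isCompact_closedBall p0 δ).of_isClosed_subset ?_ Set.inter_subset_left
      exact (hGx.mono hball).preimage_isClosed_of_isClosed Metric.isClosed_closedBall
        isClosed_singleton
    have hcomp2 : IsCompact (ft '' (Z ∩ Metric.closedBall p0 δ)) :=
      hcomp.image_of_continuousOn (hft.continuousOn.mono fun p hp => hp.1.1)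
    rw [Measure.volume_eq_prod, Measure.measure_prod_null hcomp2.measurableSet]
    refine Filter.Eventually.of_forall fun t => ?_
    let gt : (Fin (S+1) → ℝ) → (Fin S → ℝ) := fun u => G (t, u)
    let Tt : Set (Fin (S+1) → ℝ) := {u | (t, u) ∈ T}
    have hTt : IsOpen Tt := hT.preimage (by fun_prop : Continuous fun u : Fin (S+1) → ℝ => (t, u))
    have hgt : ContDiffOn ℝ 2 gt Tt :=
      hG.comp (contDiff_prodMk_right t).contDiffOn (fun u hu => hu)
    refine measure_mono_null ?_ (aux_zero_deriv (k := S) (by omega) gt Tt hTt hgt)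
    rintro z ⟨⟨t', u⟩, ⟨⟨hpT, hp0⟩, -⟩, hpz⟩
    have h1 : t' = t := by
      have := hft1 _ hpT
      rw [hpz] at this
      exact this.symm
    subst h1
    refine ⟨u, ⟨hpT, ?_⟩, congrArg Prod.snd hpz⟩
    have hd : HasFDerivAt G (fderiv ℝ G (t', u)) (t', u) :=
      ((hG.contDiffAt (hT.mem_nhds hpT)).differentiableAt (by norm_num)).hasFDerivAt
    have := (hd.comp u (hasFDerivAt_prodMk_right t' u)).fderiv
    exact this.trans hp0
  have hae : Measure.map e μ ≪ volume := by
    have : (Measure.map e μ).IsAddHaarMeasure := ContinuousLinearEquiv.isAddHaarMeasure_map e μ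
    rw [Measure.volume_eq_prod]
    have : ((volume : Measure (Fin r → ℝ)).prod
        (volume : Measure (Fin S → ℝ))).IsAddHaarMeasure :=
      Measure.prod.instIsAddHaarMeasure _ _
    exact Measure.absolutelyContinuous_isAddHaarMeasure _ _
  have hnull2 := hae hnull
  have hme : Measure.map e μ (ft '' Z) = μ (e ⁻¹' (ft '' Z)) :=
    e.toHomeomorph.toMeasurableEquiv.map_apply _
  rw [hme] at hnull2
  refine measure_mono_null ?_ hnull2
  rintro _ ⟨x, ⟨⟨⟨hxO, hxns⟩, hxr⟩, u, huT, hux⟩, rfl⟩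
  refine ⟨(h x, u), ⟨huT, ?_⟩, by simp only [ft, hux]⟩
  set p := (h x, u) with hp
  have hdψ : HasFDerivAt ψ (fderiv ℝ ψ p) p :=
    ((hψ.contDiffAt (hT.mem_nhds huT)).differentiableAt (by norm_num)).hasFDerivAt
  have hdfx : HasFDerivAt f (fderiv ℝ f x) (ψ p) := by rw [hux]; exact hdf x hxO
  let D := (e : F →L[ℝ] (Fin r → ℝ) × (Fin S → ℝ)).comp ((fderiv ℝ f x).comp (fderiv ℝ ψ p))
  have hdft : HasFDerivAt ft D p := e.hasFDerivAt.comp p (hdfx.comp p hdψ)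
  have hD1 : ∀ v, (D v).1 = v.1 := by
    intro v
    have h1 : HasFDerivAt (fun p => (ft p).1) ((ContinuousLinearMap.fst ℝ _ _).comp D) p :=
      hasFDerivAt_fst.comp p hdft
    have h2 : HasFDerivAt (fun p => (ft p).1) (ContinuousLinearMap.fst ℝ _ _) p := by
      refine hasFDerivAt_fst.congr_of_eventuallyEq ?_
      filter_upwards [hT.mem_nhds huT] with q hq using hft1 q hq
    have := h1.unique h2
    exact congrArg (fun A => A v) this
  have hGd : fderiv ℝ G p = (ContinuousLinearMap.snd ℝ _ _).comp D :=
    (hasFDerivAt_snd.comp p hdft).fderiv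
  let W := (LinearMap.range (fderiv ℝ f x : E →ₗ[ℝ] F)).map
    (e.toLinearEquiv : F →ₗ[ℝ] (Fin r → ℝ) × (Fin S → ℝ))
  have hW : Module.finrank ℝ W = r := by
    exact (LinearEquiv.finrank_map_eq e.toLinearEquiv _).trans hxr
  have hDW : ∀ v, D v ∈ W := fun v => ⟨_, ⟨fderiv ℝ ψ p v, rfl⟩, rfl⟩
  have hlin := aux_lin W hW (fun t => ⟨D (t, 0), hDW _, hD1 _⟩)
  change (fderiv ℝ G p).comp J = 0
  ext1 v
  rw [hGd]
  have := hlin (D (0, v)) (hDW _) (hD1 _)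
  exact congrArg Prod.snd this

/-- **Generalized Parametrized Sard's Theorem** (Chow–Mallet-Paret–Yorke).
If `ρ : ℝ^m × ℝ × ℝⁿ → ℝⁿ` is C² on an open neighborhood of `U × [α,β) × V`
(`U`, `V` open) and is transversal to zero on `U × [α,β) × V` (α ≤ 0 ≤ 1 ≤ β), then for
Lebesgue-almost every `c ∈ U` the map `ρ_c = ρ(c,·,·)` is transversal to zero
on `[α,β) × V`. -/
theorem generalized_parametrized_sard
    (α β : ℝ) (hα : α ≤ 0) (hβ : 1 ≤ β)
    (m n : ℕ)
    (U : Set (EuclideanSpace ℝ (Fin m))) (V : Set (EuclideanSpace ℝ (Fin n)))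
    (hU : IsOpen U) (hV : IsOpen V)
    (ρ : EuclideanSpace ℝ (Fin m) × ℝ × EuclideanSpace ℝ (Fin n) →
      EuclideanSpace ℝ (Fin n))
    (N : Set (EuclideanSpace ℝ (Fin m) × ℝ × EuclideanSpace ℝ (Fin n)))
    (hN : IsOpen N)
    (hNsub : U ×ˢ (Set.Ico α β) ×ˢ V ⊆ N)
    (hC2 : ContDiffOn ℝ 2 ρ N)
    (htrans : ∀ c κ y, c ∈ U → κ ∈ Set.Ico α β → y ∈ V →
      ρ (c, κ, y) = 0 → Function.Surjective (fderiv ℝ ρ (c, κ, y))) :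
    ∀ᵐ c ∂(volume : Measure (EuclideanSpace ℝ (Fin m))), c ∈ U →
      ∀ κ y, κ ∈ Set.Ico α β → y ∈ V → ρ (c, κ, y) = 0 →
        Function.Surjective
          (fderiv ℝ (fun p : ℝ × EuclideanSpace ℝ (Fin n) => ρ (c, p.1, p.2))
            (κ, y)) := by
  let E1 := EuclideanSpace ℝ (Fin m)
  let E2 := EuclideanSpace ℝ (Fin n)
  let Sbad : Set (E1 × ℝ × E2) := {q | q ∈ U ×ˢ (Set.Ico α β) ×ˢ V ∧ ρ q = 0 ∧
    ¬ Function.Surjective (fderiv ℝ (fun p : ℝ × E2 => ρ (q.1, p.1, p.2)) q.2)}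
  have hmain : volume (Prod.fst '' Sbad) = 0 := by
    apply aux_locally_null
    rintro ⟨c, κ, y⟩ ⟨⟨hc, hκ, hy⟩, hz, -⟩
    have haN : (c, κ, y) ∈ N := hNsub ⟨hc, hκ, hy⟩
    obtain ⟨T, ψ, hT, hψ, hTN, hev⟩ := aux_straighten (m + 1)
      (by simp; omega) 2 two_ne_zero ρ N hN (by exact_mod_cast hC2) (c, κ, y) haN
      (htrans c κ y hc hκ hy hz)
    refine ⟨_, hev, ?_⟩
    let T0 : Set (Fin (m+1) → ℝ) := {u | ((0 : E2), u) ∈ T}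
    have hT0 : IsOpen T0 :=
      hT.preimage (by fun_prop : Continuous fun u : Fin (m+1) → ℝ => ((0 : E2), u))
    let φ : (Fin (m+1) → ℝ) → E1 × ℝ × E2 := fun u => ψ (0, u)
    have hφ : ContDiffOn ℝ 2 φ T0 := by
      have hψ2 : ContDiffOn ℝ 2 ψ T := by exact_mod_cast hψ
      exact hψ2.comp (contDiff_prodMk_right (0 : E2)).contDiffOn (fun u hu => hu)
    let f : (Fin (m+1) → ℝ) → E1 := fun u => (φ u).1
    have hf : ContDiffOn ℝ 2 f T0 := contDiff_fst.comp_contDiffOn hφ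
    refine measure_mono_null ?_ (aux_sard volume (by simp [E1]) f T0 hT0 hf)
    rintro _ ⟨q, ⟨⟨hqU, hq0, hqns⟩, u, huT, huq⟩, rfl⟩
    rw [hq0] at huT huq
    refine ⟨u, ⟨huT, fun hs => hqns ?_⟩, by simp only [f, φ, huq]⟩
    have hqN : q ∈ N := hNsub hqU
    have hdρ : HasFDerivAt ρ (fderiv ℝ ρ q) q :=
      ((hC2.contDiffAt (hN.mem_nhds hqN)).differentiableAt (by norm_num)).hasFDerivAt
    have hdφ : HasFDerivAt φ (fderiv ℝ φ u) u :=
      ((hφ.contDiffAt (hT0.mem_nhds huT)).differentiableAt (by norm_num)).hasFDerivAt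
    have hdf : fderiv ℝ f u = (ContinuousLinearMap.fst ℝ _ _).comp (fderiv ℝ φ u) :=
      (hasFDerivAt_fst.comp u hdφ).fderiv
    have hker : (fderiv ℝ ρ q).comp (fderiv ℝ φ u) = 0 := by
      have hφu : φ u = q := huq
      have h1 : HasFDerivAt (fun u => ρ (φ u)) ((fderiv ℝ ρ q).comp (fderiv ℝ φ u)) u :=
        HasFDerivAt.comp u (by rw [hφu]; exact hdρ) hdφ
      have h2 : HasFDerivAt (fun u => ρ (φ u)) (0 : (Fin (m+1) → ℝ) →L[ℝ] E2) u := by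
        refine (hasFDerivAt_const (0 : E2) u).congr_of_eventuallyEq ?_
        filter_upwards [hT0.mem_nhds huT] with v hv using (hTN _ hv).2
      exact h1.unique h2
    have hd2 : fderiv ℝ (fun p : ℝ × E2 => ρ (q.1, p.1, p.2)) q.2 =
        (fderiv ℝ ρ q).comp (ContinuousLinearMap.inr ℝ E1 (ℝ × E2)) :=
      (HasFDerivAt.comp (g := ρ) (f := fun p : ℝ × E2 => (q.1, p)) q.2 hdρ
        (hasFDerivAt_prodMk_right q.1 q.2)).fderiv
    rw [hd2]
    intro w
    obtain ⟨⟨v1, v2⟩, hv⟩ := htrans q.1 q.2.1 q.2.2 hqU.1 hqU.2.1 hqU.2.2 hq0 w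
    obtain ⟨b, hb⟩ := hs v1
    rw [hdf] at hb
    have hb' : (fderiv ℝ φ u b).1 = v1 := hb
    refine ⟨v2 - (fderiv ℝ φ u b).2, ?_⟩
    have h3 : fderiv ℝ ρ q (fderiv ℝ φ u b) = 0 := congrArg (fun A => A b) hker
    have h4 : ((0 : E1), v2 - (fderiv ℝ φ u b).2) = (v1, v2) - fderiv ℝ φ u b := by
      ext1
      · simp [hb']
      · simp
    change fderiv ℝ ρ q ((0 : E1), v2 - (fderiv ℝ φ u b).2) = w
    rw [h4, map_sub, h3, sub_zero]
    exact hv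
  rw [ae_iff]
  refine measure_mono_null ?_ hmain
  intro c hc
  simp only [Set.mem_ofPred_eq, not_forall] at hc
  obtain ⟨hcU, κ, y, hκ, hy, h0, hns⟩ := hc
  exact ⟨(c, κ, y), ⟨⟨hcU, hκ, hy⟩, h0, hns⟩, rfl⟩
end

section
/- Let F : ℝ × ℝⁿ → ℝⁿ be continuously differentiable, and let p ∈ ℝ × ℝⁿ satisfy F(p) = 0 and suppose the Fréchet derivative DF(p) : ℝ × ℝⁿ → ℝⁿ is surjective. Then there exist ε > 0, a continuously differentiable curve γ : (-ε, ε) → ℝ × ℝⁿ, and an open neighborhood W of p such that γ(0) = p, the derivative γ'(s) is nonzero for all s ∈ (-ε, ε), F(γ(s)) = 0 for all s ∈ (-ε, ε), and {q ∈ W : F(q) = 0} = γ((-ε, ε)) ∩ W. -/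
open Set

/-- Local structure of the zero set of a C¹ map `F : ℝ × ℝⁿ → ℝⁿ` at a point
where `0` is a regular value: through any zero `p` of `F` at which `DF(p)` is
surjective, the zero set of `F` is locally a continuously differentiable,
regular (nonvanishing-derivative) curve. -/
theorem zero_set_locally_a_curve
    (n : ℕ)
    (F : ℝ × EuclideanSpace ℝ (Fin n) → EuclideanSpace ℝ (Fin n))
    (hF : ContDiff ℝ 1 F)
    (p : ℝ × EuclideanSpace ℝ (Fin n))
    (hp : F p = 0)
    (hsurj : Function.Surjective (fderiv ℝ F p)) :
    ∃ ε > (0:ℝ),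
      ∃ γ γ' : ℝ → ℝ × EuclideanSpace ℝ (Fin n),
        ∃ W : Set (ℝ × EuclideanSpace ℝ (Fin n)),
          IsOpen W ∧ p ∈ W ∧
          γ 0 = p ∧
          ContinuousOn γ' (Set.Ioo (-ε) ε) ∧
          (∀ s ∈ Set.Ioo (-ε) ε, HasDerivAt γ (γ' s) s) ∧
          (∀ s ∈ Set.Ioo (-ε) ε, γ' s ≠ 0) ∧
          (∀ s ∈ Set.Ioo (-ε) ε, F (γ s) = 0) ∧
          {q ∈ W | F q = 0} = γ '' Set.Ioo (-ε) ε ∩ W := by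
  classical
  let D := fderiv ℝ F p
  have hrank : Module.finrank ℝ (LinearMap.ker D.toLinearMap) = 1 := by
    have h := LinearMap.finrank_range_add_finrank_ker D.toLinearMap
    have hr : LinearMap.range D.toLinearMap = ⊤ := LinearMap.range_eq_top.2 hsurj
    rw [hr, finrank_top, Module.finrank_prod] at h
    simp only [finrank_euclideanSpace, Fintype.card_fin, Module.finrank_self] at h
    omega
  obtain ⟨v, hv0, hv⟩ := finrank_eq_one_iff'.1 hrank
  have hv0' : (v : ℝ × EuclideanSpace ℝ (Fin n)) ≠ 0 := fun h => hv0 (Subtype.ext h)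
  obtain ⟨l, hl⟩ := SeparatingDual.exists_eq_one (R := ℝ) hv0'
  let L : ℝ × EuclideanSpace ℝ (Fin n) →L[ℝ] EuclideanSpace ℝ (Fin n) × ℝ := D.prod l
  have hinj : Function.Injective L.toLinearMap := by
    rw [injective_iff_map_eq_zero]
    intro x hx
    have h1 : D x = 0 := congrArg Prod.fst hx
    have h2 : l x = 0 := congrArg Prod.snd hx
    obtain ⟨c, hc⟩ := hv ⟨x, h1⟩
    have hc' : c • (v : ℝ × EuclideanSpace ℝ (Fin n)) = x := congrArg Subtype.val hc
    rw [← hc', map_smul, hl, smul_eq_mul, mul_one] at h2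
    rw [← hc', h2, zero_smul]
  have hfr : Module.finrank ℝ (ℝ × EuclideanSpace ℝ (Fin n)) = Module.finrank ℝ (EuclideanSpace ℝ (Fin n) × ℝ) := by
    rw [Module.finrank_prod, Module.finrank_prod, add_comm]
  let L' : (ℝ × EuclideanSpace ℝ (Fin n)) ≃L[ℝ] (EuclideanSpace ℝ (Fin n) × ℝ) :=
    (LinearEquiv.ofInjectiveOfFinrankEq L.toLinearMap hinj hfr).toContinuousLinearEquiv
  have hL' : (L' : ℝ × EuclideanSpace ℝ (Fin n) →L[ℝ] EuclideanSpace ℝ (Fin n) × ℝ) = L := by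
    ext x <;> rfl
  let G : ℝ × EuclideanSpace ℝ (Fin n) → EuclideanSpace ℝ (Fin n) × ℝ := fun q => (F q, l (q - p))
  have hG : ContDiff ℝ 1 G := hF.prodMk (l.contDiff.comp (contDiff_id.sub contDiff_const))
  have hGd : HasFDerivAt G (L' : ℝ × EuclideanSpace ℝ (Fin n) →L[ℝ] EuclideanSpace ℝ (Fin n) × ℝ) p := by
    rw [hL']
    refine HasFDerivAt.prodMk (hF.differentiable one_ne_zero p).hasFDerivAt ?_
    exact l.hasFDerivAt.comp p ((hasFDerivAt_id p).sub_const p)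
  have hGp : G p = (0, 0) := by simp [G, hp]
  let e := hG.contDiffAt.toOpenPartialHomeomorph G hGd one_ne_zero
  have he : ∀ q, e q = G q := fun q => rfl
  have hps : p ∈ e.source := hG.contDiffAt.mem_toOpenPartialHomeomorph_source hGd one_ne_zero
  have h0t : ((0, 0) : EuclideanSpace ℝ (Fin n) × ℝ) ∈ e.target := by
    rw [← hGp]; exact e.map_source hps
  have hsymm0 : e.symm (0, 0) = p := by
    rw [← hGp]; exact e.left_inv hps
  have hsm : ContDiffAt ℝ 1 e.symm ((0, 0) : EuclideanSpace ℝ (Fin n) × ℝ) := by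
    rw [← hGp]; exact hG.contDiffAt.to_localInverse hGd one_ne_zero
  let γ : ℝ → ℝ × EuclideanSpace ℝ (Fin n) := fun s => e.symm (0, s)
  have hγ : ContDiffAt ℝ 1 γ 0 :=
    ContDiffAt.comp (0:ℝ) (g := e.symm) (f := fun s : ℝ => ((0 : EuclideanSpace ℝ (Fin n)), s)) hsm
      (contDiffAt_const.prodMk contDiffAt_id)
  have hev1 : ∀ᶠ s in nhds (0:ℝ), ContDiffAt ℝ 1 γ s := hγ.eventually (by simp)
  have hev2 : ∀ᶠ s in nhds (0:ℝ), ((0 : EuclideanSpace ℝ (Fin n)), s) ∈ e.target :=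
    (Continuous.continuousAt (f := fun s : ℝ => ((0 : EuclideanSpace ℝ (Fin n)), s)) (by fun_prop)).eventually
      (e.open_target.mem_nhds h0t)
  obtain ⟨ε, hε, hb⟩ := Metric.eventually_nhds_iff_ball.1 (hev1.and hev2)
  rw [Real.ball_eq_Ioo, zero_sub, zero_add] at hb
  have hGγ : ∀ s ∈ Set.Ioo (-ε) ε, G (γ s) = (0, s) := fun s hs => e.right_inv (hb s hs).2
  have hder : ∀ s ∈ Set.Ioo (-ε) ε, HasDerivAt γ (deriv γ s) s := fun s hs =>
    ((hb s hs).1.differentiableAt one_ne_zero).hasDerivAt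
  refine ⟨ε, hε, γ, deriv γ, e.source ∩ (fun q => l (q - p)) ⁻¹' Set.Ioo (-ε) ε,
    e.open_source.inter (isOpen_Ioo.preimage (by fun_prop)), ⟨hps, by simp [hε]⟩, hsymm0,
    ?_, hder, ?_, fun s hs => congrArg Prod.fst (hGγ s hs), ?_⟩
  · have : ContDiffOn ℝ 1 γ (Set.Ioo (-ε) ε) := fun s hs => (hb s hs).1.contDiffWithinAt
    exact this.continuousOn_deriv_of_isOpen isOpen_Ioo le_rfl
  · intro s hs h0
    have h1 : HasDerivAt (fun t => l (γ t - p)) (l (deriv γ s)) s :=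
      l.hasFDerivAt.comp_hasDerivAt s ((hder s hs).sub_const p)
    have h2 : (fun t => l (γ t - p)) =ᶠ[nhds s] id := by
      filter_upwards [isOpen_Ioo.mem_nhds hs] with t ht
      exact congrArg Prod.snd (hGγ t ht)
    have h3 := h1.unique ((hasDerivAt_id s).congr_of_eventuallyEq h2)
    rw [h0, map_zero] at h3
    exact zero_ne_one h3
  · ext q
    constructor
    · rintro ⟨hq, hFq⟩
      refine ⟨⟨l (q - p), hq.2, ?_⟩, hq⟩
      have : e q = (0, l (q - p)) := by rw [he]; exact Prod.ext hFq rfl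
      change e.symm (0, l (q - p)) = q
      rw [← this]
      exact e.left_inv hq.1
    · rintro ⟨⟨s, hs, rfl⟩, hq⟩
      exact ⟨hq, congrArg Prod.fst (hGγ s hs)⟩
end

section
/- Let U ⊆ ℝ^m and V ⊆ ℝⁿ be open sets, and let ρ : ℝ^m × ℝ × ℝⁿ → ℝⁿ be a map that is twice continuously differentiable on an open neighborhood of U × (0,1) × V. Suppose that for every (c,κ,y) ∈ U × (0,1) × V with ρ(c,κ,y) = 0, the Fréchet derivative of ρ at (c,κ,y) (with respect to all variables) is surjective onto ℝⁿ. Then for Lebesgue-almost every c ∈ U, the zero set of ρ_c := ρ(c,·,·) in (0,1) × V consists locally of smooth non-intersecting curves: for every (κ,y) ∈ (0,1) × V with ρ(c,κ,y) = 0, there exist ε > 0, a continuously differentiable curve γ : (-ε,ε) → ℝ × ℝⁿ with γ(0) = (κ,y) and nonvanishing derivative, and an open neighborhood W of (κ,y), such that ρ(c, γ(s)) = 0 for all s ∈ (-ε,ε) and {(κ',y') ∈ W : ρ(c,κ',y') = 0} = γ((-ε,ε)) ∩ W. -/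
open MeasureTheory Set
open Topology Filter Metric Module
open scoped Pointwise NNReal ENNReal

lemma aux_lin_s5 {E F : Type} [NormedAddCommGroup E] [NormedSpace ℝ E] [FiniteDimensional ℝ E]
    [NormedAddCommGroup F] [NormedSpace ℝ F] [FiniteDimensional ℝ F]
    (A : E →L[ℝ] F) (hs : Function.Surjective A) :
    ∃ (P : E →L[ℝ] A.ker) (Le : E ≃L[ℝ] F × A.ker),
      (Le : E →L[ℝ] F × A.ker) = A.prod P := by
  obtain ⟨P, hP⟩ := Submodule.ClosedComplemented.of_finiteDimensional A.ker
  set L : E →L[ℝ] F × A.ker := A.prod P with hL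
  have hinj : Function.Injective L := by
    rw [injective_iff_map_eq_zero]
    intro a ha
    have h1 : A a = 0 := congrArg Prod.fst ha
    have h2 : P a = 0 := congrArg Prod.snd ha
    have h3 := hP ⟨a, h1⟩
    simp only at h3
    rw [h2] at h3
    exact (congrArg Subtype.val h3).symm
  have hsur : Function.Surjective L := by
    rintro ⟨v, k⟩
    obtain ⟨a, rfl⟩ := hs v
    refine ⟨a - (P a : E) + k, ?_⟩
    have hk : A (k : E) = 0 := k.2
    have hk' : A (P a : E) = 0 := (P a).2
    ext1
    · simp [hL, hk, hk']
    · simp [hL, hP]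
  let Le : E ≃L[ℝ] F × A.ker :=
    (LinearEquiv.ofBijective (L : E →ₗ[ℝ] _) ⟨hinj, hsur⟩).toContinuousLinearEquiv
  exact ⟨P, Le, by ext x <;> rfl⟩

/-- Straightening of a submersion. -/
lemma aux_straighten_s5 {E F : Type} [NormedAddCommGroup E] [NormedSpace ℝ E] [FiniteDimensional ℝ E]
    [NormedAddCommGroup F] [NormedSpace ℝ F] [FiniteDimensional ℝ F]
    (f : E → F) (x₀ : E) (O : Set E) (hO : IsOpen O) (hx₀ : x₀ ∈ O)
    (hf : ContDiffAt ℝ 2 f x₀) (hs : Function.Surjective (fderiv ℝ f x₀)) :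
    ∃ e : OpenPartialHomeomorph E (F × (fderiv ℝ f x₀).ker),
      x₀ ∈ e.source ∧ e.source ⊆ O ∧ (∀ x, (e x).1 = f x) ∧
      (∀ x ∈ e.source, ContDiffAt ℝ 2 e x) ∧ (∀ q ∈ e.target, ContDiffAt ℝ 2 e.symm q) := by
  obtain ⟨P, Le, hLe⟩ := aux_lin_s5 _ hs
  let G : E → F × (fderiv ℝ f x₀).ker := fun x => (f x, P x)
  have hG : ContDiffAt ℝ 2 G x₀ := hf.prodMk P.contDiff.contDiffAt
  have hG' : HasFDerivAt G (Le : E →L[ℝ] _) x₀ := by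
    rw [hLe]
    exact (hf.differentiableAt (by norm_num)).hasFDerivAt.prodMk P.hasFDerivAt
  let e₀ := hG.toOpenPartialHomeomorph G hG' (by norm_num)
  have he₀ : ∀ x, e₀ x = G x := fun x => rfl
  have hx0 : x₀ ∈ e₀.source := hG.mem_toOpenPartialHomeomorph_source hG' (by norm_num)
  have hinv : ContDiffAt ℝ 2 e₀.symm (e₀ x₀) := hG.to_localInverse hG' (by norm_num)
  have ev1 : ∀ᶠ x in 𝓝 x₀, ContDiffAt ℝ 2 G x := hG.eventually (by simp)
  have ev2 : ∀ᶠ x in 𝓝 x₀, ContDiffAt ℝ 2 e₀.symm (e₀ x) :=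
    (e₀.continuousAt hx0).eventually (hinv.eventually (by simp))
  obtain ⟨T, hT, hTo, hxT⟩ := _root_.mem_nhds_iff.1 (inter_mem (ev1.and ev2) (hO.mem_nhds hx₀))
  refine ⟨e₀.restrOpen T hTo, ⟨hx0, hxT⟩, fun x hx => (hT hx.2).2, fun x => rfl,
    fun x hx => (hT hx.2).1.1, fun q hq => ?_⟩
  have h1 := (e₀.restrOpen T hTo).map_target hq
  have h2 := (hT h1.2).1.2
  have h3 := (e₀.restrOpen T hTo).right_inv hq
  have h4 : e₀ ((e₀.restrOpen T hTo).symm q) = q := h3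
  rw [h4] at h2
  exact h2

lemma aux_ae_zero {E G : Type*} [NormedAddCommGroup E] [NormedSpace ℝ E] [FiniteDimensional ℝ E]
    [NormedAddCommGroup G] [NormedSpace ℝ G] [MeasurableSpace E] [BorelSpace E]
    (μ : Measure E) [μ.IsAddHaarMeasure] (f : E → G) (s : Set E) (f' : E → E →L[ℝ] G)
    (hs : MeasurableSet s) (h0 : ∀ x ∈ s, f x = 0)
    (hf' : ∀ x ∈ s, HasFDerivAt f (f' x) x) : ∀ᵐ x ∂μ.restrict s, f' x = 0 := by
  filter_upwards [Besicovitch.ae_tendsto_measure_inter_div μ s, ae_restrict_mem hs]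
  intro x hx xs
  ext z
  simp only [_root_.zero_apply]
  rw [← norm_le_zero_iff]
  suffices H : ∀ ε, 0 < ε → ‖(f' x) z‖ ≤ ε * (‖z‖ + ε) + ‖f' x‖ * ε by
    have :
      Tendsto (fun ε : ℝ => ε * (‖z‖ + ε) + ‖f' x‖ * ε) (𝓝[>] 0)
        (𝓝 (0 * (‖z‖ + 0) + ‖f' x‖ * 0)) :=
      Tendsto.mono_left (Continuous.tendsto (by fun_prop) 0) nhdsWithin_le_nhds
    simp only [add_zero, mul_zero, zero_mul] at this
    apply le_of_tendsto_of_tendsto tendsto_const_nhds this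
    filter_upwards [self_mem_nhdsWithin]
    exact H
  intro ε εpos
  have B₁ : ∀ᶠ r in 𝓝[>] (0 : ℝ), (s ∩ ({x} + r • closedBall z ε)).Nonempty :=
    Measure.eventually_nonempty_inter_smul_of_density_one μ s x hx _ measurableSet_closedBall
      (measure_closedBall_pos μ z εpos).ne'
  obtain ⟨ρ, ρpos, hρ⟩ :
    ∃ ρ > 0, ball x ρ ⊆ {y : E | ‖f y - f x - (f' x) (y - x)‖ ≤ ε * ‖y - x‖} :=
    Metric.mem_nhds_iff.1 ((hf' x xs).isLittleO.def εpos)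
  have B₂ : ∀ᶠ r in 𝓝[>] (0 : ℝ), {x} + r • closedBall z ε ⊆ ball x ρ := by
    apply nhdsWithin_le_nhds
    exact eventually_singleton_add_smul_subset isBounded_closedBall (ball_mem_nhds x ρpos)
  obtain ⟨r, ⟨y, ⟨ys, hy⟩⟩, rρ, rpos⟩ :
    ∃ r : ℝ,
      (s ∩ ({x} + r • closedBall z ε)).Nonempty ∧ {x} + r • closedBall z ε ⊆ ball x ρ ∧ 0 < r :=
    (B₁.and (B₂.and self_mem_nhdsWithin)).exists
  obtain ⟨a, az, ya⟩ : ∃ a, a ∈ closedBall z ε ∧ y = x + r • a := by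
    simp only [mem_smul_set, image_add_left, mem_preimage, singleton_add] at hy
    rcases hy with ⟨a, az, ha⟩
    exact ⟨a, az, by simp only [ha, add_neg_cancel_left]⟩
  have norm_a : ‖a‖ ≤ ‖z‖ + ε :=
    calc
      ‖a‖ = ‖z + (a - z)‖ := by simp only [add_sub_cancel]
      _ ≤ ‖z‖ + ‖a - z‖ := norm_add_le _ _
      _ ≤ ‖z‖ + ε := by grw [mem_closedBall_iff_norm.1 az]
  have I : r * ‖(f' x) a‖ ≤ r * (ε * (‖z‖ + ε)) :=
    calc
      r * ‖(f' x) a‖ = ‖(f' x) (r • a)‖ := by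
        simp only [map_smul, norm_smul, Real.norm_eq_abs, abs_of_nonneg rpos.le]
      _ = ‖f y - f x - (f' x) (y - x)‖ := by
        rw [h0 y ys, h0 x xs, ya]; simp [norm_neg]
      _ ≤ ε * ‖y - x‖ := hρ (rρ hy)
      _ = r * (ε * ‖a‖) := by
        simp only [ya, add_sub_cancel_left, norm_smul, Real.norm_eq_abs, abs_of_nonneg rpos.le]
        ring
      _ ≤ r * (ε * (‖z‖ + ε)) := by gcongr
  have I' := le_of_mul_le_mul_left I rpos
  calc
    ‖(f' x) z‖ = ‖(f' x) a + (f' x) (z - a)‖ := by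
      congr 1
      simp only [map_sub]
      abel
    _ ≤ ‖(f' x) a‖ + ‖(f' x) (z - a)‖ := norm_add_le _ _
    _ ≤ ε * (‖z‖ + ε) + ‖f' x‖ * ‖z - a‖ := by
      gcongr
      exact ContinuousLinearMap.le_opNorm _ _
    _ ≤ ε * (‖z‖ + ε) + ‖f' x‖ * ε := by
      gcongr
      rw [mem_closedBall', dist_eq_norm] at az
      exact az

lemma aux_image_local {E F : Type*} [TopologicalSpace E] [SecondCountableTopology E]
    [MeasurableSpace F] (μ : Measure F) (f : E → F) (S : Set E)
    (h : ∀ x ∈ S, ∃ u ∈ 𝓝 x, μ (f '' (S ∩ u)) = 0) : μ (f '' S) = 0 := by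
  choose! u hu hu0 using h
  obtain ⟨t, htS, htc, hcov⟩ := TopologicalSpace.countable_cover_nhdsWithin
    (f := u) (s := S) (fun x hx => mem_nhdsWithin_of_mem_nhds (hu x hx))
  have : f '' S ⊆ ⋃ x ∈ t, f '' (S ∩ u x) := by
    rintro _ ⟨x, hx, rfl⟩
    obtain ⟨y, hy, hxy⟩ := mem_iUnion₂.1 (hcov hx)
    exact mem_iUnion₂.2 ⟨y, hy, x, ⟨hx, hxy⟩, rfl⟩
  refine measure_mono_null this ?_
  rw [measure_biUnion_null_iff htc]
  exact fun x hx => hu0 x (htS hx)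

lemma aux_quad_radius {E F : Type*} [NormedAddCommGroup E] [NormedSpace ℝ E]
    [NormedAddCommGroup F] [NormedSpace ℝ F] (f : E → F) (x : E) (K : ℝ)
    (hf : ContDiffAt ℝ 2 f x) (h0 : fderiv ℝ f x = 0) (hK : ‖fderiv ℝ (fderiv ℝ f) x‖ < K)
    (δ : ℝ) (hδ : 0 < δ) :
    ∃ r, 0 < r ∧ r < δ ∧ ∀ z ∈ closedBall x r, ‖f z - f x‖ ≤ K * r ^ 2 := by
  have hD : ContDiffAt ℝ 1 (fderiv ℝ f) x := hf.fderiv_right (by norm_num)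
  have hD2 : HasFDerivAt (fderiv ℝ f) (fderiv ℝ (fderiv ℝ f) x) x :=
    (hD.differentiableAt (by norm_num)).hasFDerivAt
  have h1 := hD2.isLittleO.def (sub_pos.2 hK)
  have h2 : ∀ᶠ z in 𝓝 x, DifferentiableAt ℝ f z :=
    (hf.eventually (by simp)).mono fun z hz => hz.differentiableAt (by norm_num)
  obtain ⟨r₀, hr₀, hb⟩ := Metric.eventually_nhds_iff_ball.1 (h1.and h2)
  refine ⟨min r₀ δ / 2, by positivity, ?_, ?_⟩
  · have := min_le_right r₀ δ
    linarith
  set r := min r₀ δ / 2 with hr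
  have hrp : 0 < r := by positivity
  have hlt : r < r₀ := by
    have := min_le_left r₀ δ
    linarith
  intro z hz
  have hK0 : 0 < K := (norm_nonneg (fderiv ℝ (fderiv ℝ f) x)).trans_lt hK
  have key : ∀ w ∈ closedBall x r, ‖fderiv ℝ f w‖ ≤ K * r := by
    intro w hw
    have hw' : w ∈ ball x r₀ := closedBall_subset_ball hlt hw
    have h3 := (hb w hw').1
    rw [h0, sub_zero] at h3
    have h4 : ‖w - x‖ ≤ r := mem_closedBall_iff_norm.1 hw
    calc ‖fderiv ℝ f w‖ ≤ ‖fderiv ℝ f w - fderiv ℝ (fderiv ℝ f) x (w - x)‖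
          + ‖fderiv ℝ (fderiv ℝ f) x (w - x)‖ := by
            simpa using norm_add_le (fderiv ℝ f w - fderiv ℝ (fderiv ℝ f) x (w - x))
              (fderiv ℝ (fderiv ℝ f) x (w - x))
      _ ≤ (K - ‖fderiv ℝ (fderiv ℝ f) x‖) * ‖w - x‖ + ‖fderiv ℝ (fderiv ℝ f) x‖ * ‖w - x‖ :=
          add_le_add h3 (ContinuousLinearMap.le_opNorm _ _)
      _ = K * ‖w - x‖ := by ring
      _ ≤ K * r := by gcongr
  have := (convex_closedBall x r).norm_image_sub_le_of_norm_fderiv_le (𝕜 := ℝ)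
    (fun w hw => (hb w (closedBall_subset_ball hlt hw)).2) key (mem_closedBall_self hrp.le) hz
  calc ‖f z - f x‖ ≤ K * r * ‖z - x‖ := this
    _ ≤ K * r * r := by
      gcongr
      exact mem_closedBall_iff_norm.1 hz
    _ = K * r ^ 2 := by ring

lemma aux_quad_cover {E F : Type*} [NormedAddCommGroup E] [NormedSpace ℝ E]
    [FiniteDimensional ℝ E] [MeasurableSpace E] [BorelSpace E]
    (μ : Measure E) [μ.IsAddHaarMeasure]
    [NormedAddCommGroup F] [NormedSpace ℝ F]
    [FiniteDimensional ℝ F] [MeasurableSpace F] [BorelSpace F]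
    (ν : Measure F) [ν.IsAddHaarMeasure] (m : ℕ) (hE : finrank ℝ E = m + 2)
    (hF : finrank ℝ F = m + 1) (f : E → F) (S : Set E) (K : ℝ) (hK0 : 0 < K)
    (hf : ∀ x ∈ S, ContDiffAt ℝ 2 f x) (h0 : ∀ x ∈ S, fderiv ℝ f x = 0)
    (hK : ∀ x ∈ S, ‖fderiv ℝ (fderiv ℝ f) x‖ < K) :
    ν (f '' S) ≤ ENNReal.ofReal (K ^ (m + 1)) *
      (ν (closedBall 0 1) / μ (closedBall 0 1)) * μ S := by
  have hμ0 : μ (closedBall 0 1) ≠ 0 := (measure_closedBall_pos μ 0 one_pos).ne'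
  have hμt : μ (closedBall 0 1) ≠ ∞ := (isCompact_closedBall 0 1).measure_lt_top.ne
  have hνt : ν (closedBall 0 1) ≠ ∞ := (isCompact_closedBall 0 1).measure_lt_top.ne
  set C := ENNReal.ofReal (K ^ (m + 1)) * (ν (closedBall 0 1) / μ (closedBall 0 1)) with hC
  have hCt : C ≠ ∞ := ENNReal.mul_ne_top ENNReal.ofReal_ne_top (ENNReal.div_ne_top hνt hμ0)
  have main : ∀ ε : ℝ≥0∞, ε ≠ 0 → ν (f '' S) ≤ C * (μ S + ε) := by
    intro ε hε
    obtain ⟨t, r, htc, htS, hr, hcov, hsum⟩ :=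
      Besicovitch.exists_closedBall_covering_tsum_measure_le μ hε
        (fun x => {r | 0 < r ∧ r < 1 ∧ ∀ z ∈ closedBall x r, ‖f z - f x‖ ≤ K * r ^ 2}) S (by
          intro x hx δ hδ
          obtain ⟨r, h1, h2, h3⟩ := aux_quad_radius f x K (hf x hx) (h0 x hx) (hK x hx)
            (min δ 1) (by positivity)
          exact ⟨r, ⟨h1, h2.trans_le (min_le_right _ _), h3⟩, h1, h2.trans_le (min_le_left _ _)⟩)
    have hsub : f '' S ⊆ ⋃ x ∈ t, closedBall (f x) (K * r x ^ 2) := by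
      rintro _ ⟨z, hz, rfl⟩
      obtain ⟨x, hx, hzx⟩ := mem_iUnion₂.1 (hcov hz)
      exact mem_iUnion₂.2 ⟨x, hx, mem_closedBall_iff_norm.2 ((hr x hx).2.2 z hzx)⟩
    have hball : ∀ x ∈ t, ν (closedBall (f x) (K * r x ^ 2)) ≤ C * μ (closedBall x (r x)) := by
      intro x hx
      obtain ⟨h1, h2, -⟩ := hr x hx
      rw [Measure.addHaar_closedBall' ν _ (by positivity),
        Measure.addHaar_closedBall' μ _ h1.le, hE, hF, hC]
      have e1 : (K * r x ^ 2) ^ (m + 1) ≤ K ^ (m + 1) * r x ^ (m + 2) := by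
        rw [mul_pow, ← pow_mul]
        gcongr ?_ * ?_
        exact pow_le_pow_of_le_one h1.le h2.le (by omega)
      calc ENNReal.ofReal ((K * r x ^ 2) ^ (m + 1)) * ν (closedBall 0 1)
          ≤ ENNReal.ofReal (K ^ (m + 1) * r x ^ (m + 2)) * ν (closedBall 0 1) := by gcongr
        _ = ENNReal.ofReal (K ^ (m + 1)) * ENNReal.ofReal (r x ^ (m + 2)) *
              (ν (closedBall 0 1) / μ (closedBall 0 1) * μ (closedBall 0 1)) := by
            rw [ENNReal.div_mul_cancel hμ0 hμt, ENNReal.ofReal_mul (by positivity)]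
        _ = _ := by ring
    calc ν (f '' S) ≤ ν (⋃ x ∈ t, closedBall (f x) (K * r x ^ 2)) := measure_mono hsub
      _ ≤ ∑' x : t, ν (closedBall (f x) (K * r x ^ 2)) := measure_biUnion_le ν htc _
      _ ≤ ∑' x : t, C * μ (closedBall (x : E) (r x)) :=
          ENNReal.tsum_le_tsum fun x => hball x x.2
      _ = C * ∑' x : t, μ (closedBall (x : E) (r x)) := ENNReal.tsum_mul_left
      _ ≤ C * (μ S + ε) := by gcongr
  have hlim : Tendsto (fun ε : ℝ≥0∞ => C * (μ S + ε)) (𝓝[>] 0) (𝓝 (C * (μ S + 0))) := by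
    refine ENNReal.Tendsto.const_mul ?_ (Or.inr hCt)
    exact (tendsto_const_nhds.add tendsto_id).mono_left nhdsWithin_le_nhds
  rw [add_zero] at hlim
  refine ge_of_tendsto hlim ?_
  filter_upwards [self_mem_nhdsWithin] with ε hε
  exact main ε (ne_of_gt hε)

lemma aux_sard_zero {E F : Type*} [NormedAddCommGroup E] [NormedSpace ℝ E]
    [FiniteDimensional ℝ E]
    [NormedAddCommGroup F] [NormedSpace ℝ F]
    [FiniteDimensional ℝ F] [MeasurableSpace F] [BorelSpace F]
    (ν : Measure F) [ν.IsAddHaarMeasure] (m : ℕ) (hE : finrank ℝ E = m + 2)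
    (hF : finrank ℝ F = m + 1) (f : E → F) (O : Set E) (hO : IsOpen O)
    (hf : ∀ x ∈ O, ContDiffAt ℝ 2 f x) :
    ν (f '' {x | x ∈ O ∧ fderiv ℝ f x = 0}) = 0 := by
  borelize E
  let μ : Measure E := Measure.addHaar
  set A : Set E := {x | x ∈ O ∧ fderiv ℝ f x = 0} with hA
  have hAm : MeasurableSet A :=
    hO.measurableSet.inter (measurable_fderiv ℝ f (measurableSet_singleton 0))
  have hae := aux_ae_zero μ (fderiv ℝ f) A (fderiv ℝ (fderiv ℝ f)) hAm (fun x hx => hx.2)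
    (fun x hx => (((hf x hx.1).fderiv_right (m := 1) (by norm_num)).differentiableAt
      (by norm_num)).hasFDerivAt)
  rw [ae_restrict_iff' hAm] at hae
  have hμ0 : μ (closedBall 0 1) ≠ 0 := (measure_closedBall_pos μ 0 one_pos).ne'
  have hνt : ν (closedBall 0 1) ≠ ∞ := (isCompact_closedBall 0 1).measure_lt_top.ne
  have hq : ν (closedBall 0 1) / μ (closedBall 0 1) ≠ ∞ := ENNReal.div_ne_top hνt hμ0
  have hcov : f '' A ⊆ (⋃ k : ℕ, f '' {x | x ∈ A ∧ fderiv ℝ (fderiv ℝ f) x ≠ 0 ∧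
      ‖fderiv ℝ (fderiv ℝ f) x‖ < k + 1}) ∪
      (⋃ k : ℕ, f '' {x | x ∈ A ∧ fderiv ℝ (fderiv ℝ f) x = 0 ∧ x ∈ closedBall (0 : E) k}) := by
    rintro _ ⟨x, hx, rfl⟩
    by_cases h : fderiv ℝ (fderiv ℝ f) x = 0
    · right
      obtain ⟨k, hk⟩ := exists_nat_ge ‖x‖
      exact mem_iUnion.2 ⟨k, x, ⟨hx, h, by simpa using hk⟩, rfl⟩
    · left
      obtain ⟨k, hk⟩ := exists_nat_ge ‖fderiv ℝ (fderiv ℝ f) x‖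
      exact mem_iUnion.2 ⟨k, x, ⟨hx, h, by linarith⟩, rfl⟩
  refine measure_mono_null hcov (measure_union_null (measure_iUnion_null fun k => ?_)
    (measure_iUnion_null fun k => ?_))
  · have := aux_quad_cover μ ν m hE hF f {x | x ∈ A ∧ fderiv ℝ (fderiv ℝ f) x ≠ 0 ∧
      ‖fderiv ℝ (fderiv ℝ f) x‖ < k + 1} (k + 1) (by positivity) (fun x hx => hf x hx.1.1)
      (fun x hx => hx.1.2) (fun x hx => hx.2.2)
    have hz : μ {x | x ∈ A ∧ fderiv ℝ (fderiv ℝ f) x ≠ 0 ∧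
      ‖fderiv ℝ (fderiv ℝ f) x‖ < k + 1} = 0 := by
      refine measure_mono_null ?_ hae
      intro x hx hx'
      exact hx.2.1 (hx' hx.1)
    rw [hz, mul_zero] at this
    exact le_antisymm this bot_le
  · set S := {x | x ∈ A ∧ fderiv ℝ (fderiv ℝ f) x = 0 ∧ x ∈ closedBall (0 : E) k}
    have hSt : μ S ≠ ∞ := ne_top_of_le_ne_top
      (isCompact_closedBall (0 : E) k).measure_lt_top.ne (measure_mono fun x hx => hx.2.2)
    have hb : ∀ K : ℝ, 0 < K → ν (f '' S) ≤ ENNReal.ofReal (K ^ (m + 1)) *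
        ((ν (closedBall 0 1) / μ (closedBall 0 1)) * μ S) := by
      intro K hK
      rw [← mul_assoc]
      exact aux_quad_cover μ ν m hE hF f S K hK (fun x hx => hf x hx.1.1)
        (fun x hx => hx.1.2) (fun x hx => by rw [hx.2.1]; exact (norm_zero (E := E →L[ℝ] E →L[ℝ] F)).trans_lt hK)
    have hlim : Tendsto (fun K : ℝ => ENNReal.ofReal (K ^ (m + 1)) *
        ((ν (closedBall 0 1) / μ (closedBall 0 1)) * μ S)) (𝓝[>] 0)
        (𝓝 (ENNReal.ofReal (0 ^ (m + 1)) *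
        ((ν (closedBall 0 1) / μ (closedBall 0 1)) * μ S))) := by
      refine ENNReal.Tendsto.mul_const ?_ (Or.inr (ENNReal.mul_ne_top hq hSt))
      refine ENNReal.tendsto_ofReal ?_
      exact ((continuous_pow (m + 1)).tendsto 0).mono_left nhdsWithin_le_nhds
    have : ν (f '' S) ≤ _ := ge_of_tendsto hlim (by
      filter_upwards [self_mem_nhdsWithin] with K hK
      exact hb K hK)
    simpa using this

lemma aux_isOpen_surj {E F : Type*} [NormedAddCommGroup E] [NormedSpace ℝ E]
    [NormedAddCommGroup F] [NormedSpace ℝ F] [FiniteDimensional ℝ F] :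
    IsOpen {L : E →L[ℝ] F | Function.Surjective L} := by
  have h := isOpen_setOfPred_nat_le_rank (𝕜 := ℝ) (E := E) (F := F) (finrank ℝ F)
  convert h using 1
  ext L
  simp only [mem_ofPred_eq]
  constructor
  · intro hL
    have : LinearMap.range (L : E →ₗ[ℝ] F) = ⊤ := LinearMap.range_eq_top.2 hL
    rw [LinearMap.rank, this, rank_top, finrank_eq_rank]
  · intro hL
    rw [LinearMap.rank, ← finrank_eq_rank, Nat.cast_le] at hL
    have : LinearMap.range (L : E →ₗ[ℝ] F) = ⊤ :=
      Submodule.eq_top_of_finrank_eq (le_antisymm (Submodule.finrank_le _) hL)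
    exact LinearMap.range_eq_top.1 this

/-- The statement of the theorem of Sard from dimension `m + 1` to `m`, for `C²` maps. -/
def AuxSard (m : ℕ) : Prop := ∀ (E F : Type) [NormedAddCommGroup E] [NormedSpace ℝ E]
    [FiniteDimensional ℝ E] [NormedAddCommGroup F] [NormedSpace ℝ F]
    [FiniteDimensional ℝ F] [MeasurableSpace F] [BorelSpace F]
    (ν : Measure F) [ν.IsAddHaarMeasure] (_ : finrank ℝ E = m + 1)
    (_ : finrank ℝ F = m) (f : E → F) (O : Set E) (_ : IsOpen O)
    (_ : ∀ x ∈ O, ContDiffAt ℝ 2 f x),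
    ν (f '' {x | x ∈ O ∧ ¬ Function.Surjective (fderiv ℝ f x)}) = 0

lemma aux_finrank_ker {E F : Type} [NormedAddCommGroup E] [NormedSpace ℝ E]
    [FiniteDimensional ℝ E] [NormedAddCommGroup F] [NormedSpace ℝ F]
    [FiniteDimensional ℝ F] (A : E →L[ℝ] F) (hA : Function.Surjective A) :
    finrank ℝ F + finrank ℝ A.ker = finrank ℝ E := by
  have h := LinearMap.finrank_range_add_finrank_ker (A : E →ₗ[ℝ] F)
  rw [LinearMap.range_eq_top.2 hA, finrank_top] at h
  exact h

lemma aux_sard_step (m : ℕ) (ih : AuxSard m)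
    (E F : Type) [NormedAddCommGroup E] [NormedSpace ℝ E]
    [FiniteDimensional ℝ E] [NormedAddCommGroup F] [NormedSpace ℝ F]
    [FiniteDimensional ℝ F] [MeasurableSpace F] [BorelSpace F]
    (ν : Measure F) [ν.IsAddHaarMeasure] (hE : finrank ℝ E = m + 2)
    (hF : finrank ℝ F = m + 1) (f : E → F) (O : Set E) (hO : IsOpen O)
    (hf : ∀ x ∈ O, ContDiffAt ℝ 2 f x) (x₀ : E) (hx₀ : x₀ ∈ O) (h0 : fderiv ℝ f x₀ ≠ 0) :
    ∃ u ∈ 𝓝 x₀, ν (f '' ({x | x ∈ O ∧ ¬ Function.Surjective (fderiv ℝ f x)} ∩ u)) = 0 := by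
  obtain ⟨v, hv⟩ : ∃ v, fderiv ℝ f x₀ v ≠ 0 := by
    by_contra! h
    exact h0 (by ext v; simpa using h v)
  obtain ⟨l, hl⟩ := SeparatingDual.exists_ne_zero (R := ℝ) hv
  have hdf : ∀ x ∈ O, DifferentiableAt ℝ f x := fun x hx => (hf x hx).differentiableAt (by norm_num)
  have hlf : ContDiffAt ℝ 2 (fun x => l (f x)) x₀ := l.contDiff.contDiffAt.comp x₀ (hf x₀ hx₀)
  have hlf' : fderiv ℝ (fun x => l (f x)) x₀ = l.comp (fderiv ℝ f x₀) :=
    (l.hasFDerivAt.comp x₀ (hdf x₀ hx₀).hasFDerivAt).fderiv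
  have hsl : Function.Surjective l := by
    intro a
    exact ⟨(a / l (fderiv ℝ f x₀ v)) • fderiv ℝ f x₀ v, by simp [hl]⟩
  have hs : Function.Surjective (fderiv ℝ (fun x => l (f x)) x₀) := by
    rw [hlf']
    intro a
    exact ⟨(a / l (fderiv ℝ f x₀ v)) • v, by simp [hl]⟩
  obtain ⟨e, hxe, heO, he1, heC, heC'⟩ := aux_straighten_s5 _ x₀ O hO hx₀ hlf hs
  obtain ⟨P, Φ, hΦ⟩ := aux_lin_s5 l hsl
  have hΦ1 : ∀ y, (Φ y).1 = l y := fun y => congrArg (fun L => (L y).1) hΦ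
  have hK := aux_finrank_ker _ hs
  have hL := aux_finrank_ker _ hsl
  rw [finrank_self] at hK hL
  generalize hKdef : (fderiv ℝ (fun x => l (f x)) x₀).ker = K at *
  generalize hLdef : l.ker = F' at *
  let ν' : Measure F' := Measure.addHaar
  obtain ⟨r, hr, hrs⟩ := Metric.nhds_basis_closedBall.mem_iff.1 (e.open_source.mem_nhds hxe)
  refine ⟨closedBall x₀ r, closedBall_mem_nhds _ hr, ?_⟩
  set S := {x | x ∈ O ∧ ¬ Function.Surjective (fderiv ℝ f x)} ∩ closedBall x₀ r with hS
  have hScomp : IsCompact S := by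
    have hfc : ContinuousOn (fderiv ℝ f) (closedBall x₀ r) := fun x hx =>
      (((hf x (heO (hrs hx))).fderiv_right (m := 1) (by norm_num)).continuousAt).continuousWithinAt
    have hc := hfc.preimage_isClosed_of_isClosed isClosed_closedBall
      (aux_isOpen_surj (E := E) (F := F)).isClosed_compl
    have : S = closedBall x₀ r ∩ fderiv ℝ f ⁻¹' {L : E →L[ℝ] F | Function.Surjective L}ᶜ := by
      ext x
      constructor
      · rintro ⟨⟨h1, h2⟩, h3⟩
        exact ⟨h3, h2⟩
      · rintro ⟨h3, h2⟩
        exact ⟨⟨heO (hrs h3), h2⟩, h3⟩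
    rw [this]
    exact (isCompact_closedBall x₀ r).of_isClosed_subset hc inter_subset_left
  have hfS : IsCompact (f '' S) :=
    hScomp.image_of_continuousOn fun x hx => (hdf x hx.1.1).continuousAt.continuousWithinAt
  have hT : IsCompact (Φ '' (f '' S)) := hfS.image Φ.continuous
  have hnull : (volume.prod ν') (Φ '' (f '' S)) = 0 := by
    rw [Measure.measure_prod_null hT.measurableSet]
    refine Eventually.of_forall fun t => ?_
    have := ih K F' ν' (by omega) (by omega) (fun x => (Φ (f (e.symm (t, x)))).2)
      {x | (t, x) ∈ e.target} (e.open_target.preimage (by fun_prop)) (by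
        intro x hx
        have h1 := heC' _ hx
        have h2 := hf _ (heO (e.map_target hx))
        have h3 : ContDiffAt ℝ 2 (fun x : K => ((t, x) : ℝ × K)) x := by fun_prop
        exact contDiff_snd.contDiffAt.comp x (Φ.contDiff.contDiffAt.comp x
          (h2.comp x (h1.comp x h3))))
    refine measure_mono_null ?_ this
    rintro y ⟨_, ⟨p, hp, rfl⟩, hpy⟩
    have hps : p ∈ e.source := hrs hp.2
    have hep : e p = (t, (e p).2) := by
      ext1
      · rw [he1, ← hΦ1, hpy]
      · rfl
    have hsym : e.symm (t, (e p).2) = p := by rw [← hep]; exact e.left_inv hps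
    have hmem : (t, (e p).2) ∈ e.target := by rw [← hep]; exact e.map_source hps
    refine ⟨(e p).2, ⟨hmem, ?_⟩, ?_⟩
    swap
    · simp only [hsym, hpy]
    intro hsurj
    apply hp.1.2
    set x := (e p).2 with hx
    set D := fderiv ℝ e.symm (t, x) with hD
    have hDs : HasFDerivAt e.symm D (t, x) :=
      ((heC' _ hmem).differentiableAt (by norm_num)).hasFDerivAt
    have hfp : HasFDerivAt f (fderiv ℝ f p) (e.symm (t, x)) := by
      rw [hsym]; exact (hdf p (heO hps)).hasFDerivAt
    have hcomp : HasFDerivAt (fun q => f (e.symm q)) ((fderiv ℝ f p).comp D) (t, x) :=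
      hfp.comp _ hDs
    have hin : HasFDerivAt (fun x : K => ((t, x) : ℝ × K)) (ContinuousLinearMap.inr ℝ ℝ K) x :=
      hasFDerivAt_prodMk_right t x
    have hg : fderiv ℝ (fun x => (Φ (f (e.symm (t, x)))).2) x =
        (ContinuousLinearMap.snd ℝ ℝ F').comp ((Φ : F →L[ℝ] ℝ × F').comp
          (((fderiv ℝ f p).comp D).comp (ContinuousLinearMap.inr ℝ ℝ K))) :=
      (hasFDerivAt_snd.comp x (Φ.hasFDerivAt.comp x (hcomp.comp x hin))).fderiv
    rw [hg] at hsurj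
    have hfst : l.comp ((fderiv ℝ f p).comp D) = ContinuousLinearMap.fst ℝ ℝ K := by
      refine (l.hasFDerivAt.comp _ hcomp).unique (hasFDerivAt_fst.congr_of_eventuallyEq ?_)
      filter_upwards [e.open_target.mem_nhds hmem] with q hq
      simp only [Function.comp]
      rw [← he1, e.right_inv hq]
    have hfst' : ∀ q, l (fderiv ℝ f p (D q)) = q.1 := fun q => congrArg (fun L => L q) hfst
    intro y
    obtain ⟨x', hx'⟩ := hsurj ((Φ y).2 - (Φ (fderiv ℝ f p (D ((Φ y).1, 0)))).2)
    refine ⟨D ((Φ y).1, 0) + D (0, x'), ?_⟩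
    apply Φ.injective
    simp only [ContinuousLinearMap.comp_apply, ContinuousLinearMap.inr_apply,
      ContinuousLinearMap.coe_snd', ContinuousLinearEquiv.coe_coe] at hx'
    rw [map_add, map_add]
    ext1
    · simp only [Prod.fst_add, hΦ1, hfst', add_zero]
    · rw [Prod.snd_add, hx']; abel
  have hac : ν.map Φ ≪ volume.prod ν' := by
    have : (ν.map Φ).IsAddHaarMeasure := Φ.isAddHaarMeasure_map ν
    exact Measure.absolutelyContinuous_isAddHaarMeasure _ _
  have h2 := hac hnull
  rw [Measure.map_apply Φ.continuous.measurable hT.measurableSet,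
    preimage_image_eq _ Φ.injective] at h2
  exact h2

lemma aux_sard_s5 (m : ℕ) : AuxSard m := by
  induction m with
  | zero =>
    intro E F _ _ _ _ _ _ _ _ ν _ hE hF f O hO hf
    have : Subsingleton F := finrank_zero_iff.1 hF
    have : {x | x ∈ O ∧ ¬ Function.Surjective (fderiv ℝ f x)} = ∅ := by
      ext x
      simp only [mem_ofPred_eq, mem_empty_iff_false, iff_false, not_and, not_not]
      intro _ y
      exact ⟨0, Subsingleton.elim _ _⟩
    rw [this]; simp
  | succ m ih =>
    intro E F _ _ _ _ _ _ _ _ ν _ hE hF f O hO hf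
    set S := {x | x ∈ O ∧ ¬ Function.Surjective (fderiv ℝ f x)} with hS
    have hZ := aux_sard_zero ν m hE hF f O hO hf
    have hsplit : f '' S ⊆ f '' {x | x ∈ O ∧ fderiv ℝ f x = 0} ∪
        f '' (S ∩ {x | fderiv ℝ f x ≠ 0}) := by
      rintro _ ⟨x, hx, rfl⟩
      by_cases h : fderiv ℝ f x = 0
      · exact Or.inl ⟨x, ⟨hx.1, h⟩, rfl⟩
      · exact Or.inr ⟨x, ⟨hx, h⟩, rfl⟩
    refine measure_mono_null hsplit (measure_union_null hZ ?_)
    refine aux_image_local ν f _ ?_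
    rintro x₀ ⟨hx₀, h0⟩
    obtain ⟨u, hu, hu0⟩ := aux_sard_step m ih E F ν hE hF f O hO hf x₀ hx₀.1 h0
    exact ⟨u, hu, measure_mono_null (image_mono (inter_subset_inter_left _ inter_subset_left)) hu0⟩

lemma aux_curve {X Y : Type} [NormedAddCommGroup X] [NormedSpace ℝ X]
    [FiniteDimensional ℝ X] [NormedAddCommGroup Y] [NormedSpace ℝ Y]
    [FiniteDimensional ℝ Y] (hd : finrank ℝ X = finrank ℝ Y + 1) (f : X → Y) (p : X)
    (hf : ContDiffAt ℝ 2 f p) (h0 : f p = 0) (hs : Function.Surjective (fderiv ℝ f p)) :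
    ∃ ε > (0:ℝ), ∃ γ γ' : ℝ → X, ∃ W : Set X,
      IsOpen W ∧ p ∈ W ∧ γ 0 = p ∧ ContinuousOn γ' (Set.Ioo (-ε) ε) ∧
      (∀ s ∈ Set.Ioo (-ε) ε, HasDerivAt γ (γ' s) s) ∧
      (∀ s ∈ Set.Ioo (-ε) ε, γ' s ≠ 0) ∧
      (∀ s ∈ Set.Ioo (-ε) ε, f (γ s) = 0) ∧
      {q ∈ W | f q = 0} = γ '' Set.Ioo (-ε) ε ∩ W := by
  obtain ⟨e, hpe, -, he1, heC, heC'⟩ := aux_straighten_s5 f p univ isOpen_univ (mem_univ _) hf hs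
  have hK := aux_finrank_ker _ hs
  generalize (fderiv ℝ f p).ker = K at *
  have hK1 : finrank ℝ K = finrank ℝ ℝ := by rw [finrank_self]; omega
  let L : K ≃L[ℝ] ℝ := ContinuousLinearEquiv.ofFinrankEq hK1
  let j : ℝ → Y × K := fun s => (0, (e p).2 + L.symm s)
  have hj : Continuous j := by fun_prop
  have hj0 : j 0 = e p := by
    ext1
    · simp [j, he1, h0]
    · simp [j]
  have hjd : ∀ s, HasDerivAt j (0, L.symm 1) s := by
    intro s
    refine (hasDerivAt_const s (0 : Y)).prodMk ?_
    exact (L.symm.hasFDerivAt.hasDerivAt).const_add _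
  have hmem : j ⁻¹' e.target ∈ 𝓝 (0 : ℝ) :=
    (e.open_target.preimage hj).mem_nhds (by
      rw [mem_preimage, hj0]; exact e.map_source hpe)
  obtain ⟨ε, hε, hball⟩ := Metric.mem_nhds_iff.1 hmem
  have hI : ∀ s ∈ Ioo (-ε) ε, j s ∈ e.target := by
    intro s hs
    apply hball
    rw [Real.ball_eq_Ioo]
    simpa using hs
  have hw : ((0, L.symm 1) : Y × K) ≠ 0 := by
    intro h
    have : L.symm 1 = 0 := congrArg Prod.snd h
    simp at this
  have hder : ∀ s ∈ Ioo (-ε) ε, HasDerivAt (fun s => e.symm (j s))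
      (fderiv ℝ e.symm (j s) (0, L.symm 1)) s := fun s hs =>
    (((heC' _ (hI s hs)).differentiableAt (by norm_num)).hasFDerivAt).comp_hasDerivAt s (hjd s)
  refine ⟨ε, hε, fun s => e.symm (j s), fun s => fderiv ℝ e.symm (j s) (0, L.symm 1),
    e.source ∩ e ⁻¹' ((fun q : Y × K => L (q.2 - (e p).2)) ⁻¹' Ioo (-ε) ε),
    e.isOpen_inter_preimage (isOpen_Ioo.preimage (by fun_prop)), ?_, ?_, ?_, hder, ?_, ?_, ?_⟩
  · exact ⟨hpe, by simp [hε]⟩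
  · simp only [hj0]
    exact e.left_inv hpe
  · intro s hs
    have h1 := ((heC' _ (hI s hs)).fderiv_right (m := 1) (by norm_num)).continuousAt
    have h2 : ContinuousAt (fun s => fderiv ℝ e.symm (j s)) s :=
      ContinuousAt.comp (f := j) (g := fderiv ℝ e.symm) h1 hj.continuousAt
    exact (h2.clm_apply continuousAt_const).continuousWithinAt
  · intro s hs hz
    have h1 := hder s hs
    beta_reduce at hz
    rw [hz] at h1
    have h2 := ((heC _ (e.map_target (hI s hs))).differentiableAt
      (by norm_num)).hasFDerivAt.comp_hasDerivAt s h1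
    rw [map_zero] at h2
    have h3 : HasDerivAt (e ∘ fun s => e.symm (j s)) (0, L.symm 1) s := by
      refine (hjd s).congr_of_eventuallyEq ?_
      filter_upwards [isOpen_Ioo.mem_nhds hs] with t ht
      exact e.right_inv (hI t ht)
    exact hw (h3.unique h2)
  · intro s hs
    rw [← he1, e.right_inv (hI s hs)]
  · ext q
    constructor
    · rintro ⟨hq, hq0⟩
      refine ⟨⟨L ((e q).2 - (e p).2), hq.2, ?_⟩, hq⟩
      have : j (L ((e q).2 - (e p).2)) = e q := by
        ext1
        · simp [j, he1, hq0]
        · simp [j]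
      simp only [this]
      exact e.left_inv hq.1
    · rintro ⟨⟨s, hs, rfl⟩, hq⟩
      refine ⟨hq, ?_⟩
      rw [← he1, e.right_inv (hI s hs)]

lemma aux_param {X Y C : Type} [NormedAddCommGroup X] [NormedSpace ℝ X]
    [FiniteDimensional ℝ X] [NormedAddCommGroup Y] [NormedSpace ℝ Y]
    [FiniteDimensional ℝ Y] [NormedAddCommGroup C] [NormedSpace ℝ C]
    [FiniteDimensional ℝ C] [MeasurableSpace C] [BorelSpace C]
    (ν : Measure C) [ν.IsAddHaarMeasure]
    (hd : finrank ℝ X = finrank ℝ Y + 1) (f : C × X → Y) (Z : Set (C × X))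
    (hf : ∀ p ∈ Z, ContDiffAt ℝ 2 f p) (h0 : ∀ p ∈ Z, f p = 0)
    (hs : ∀ p ∈ Z, Function.Surjective (fderiv ℝ f p)) :
    ν (Prod.fst '' {p | p ∈ Z ∧ ¬ Function.Surjective (fderiv ℝ (fun x => f (p.1, x)) p.2)})
      = 0 := by
  refine aux_image_local ν _ _ ?_
  rintro p ⟨hpZ, -⟩
  obtain ⟨e, hpe, -, he1, heC, heC'⟩ :=
    aux_straighten_s5 f p univ isOpen_univ (mem_univ _) (hf p hpZ) (hs p hpZ)
  have hK := aux_finrank_ker _ (hs p hpZ)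
  rw [finrank_prod] at hK
  generalize (fderiv ℝ f p).ker = K at *
  refine ⟨e.source, e.open_source.mem_nhds hpe, ?_⟩
  have := aux_sard_s5 (finrank ℝ C) K C ν (by omega) rfl (fun x => (e.symm ((0 : Y), x)).1)
    {x | ((0 : Y), x) ∈ e.target} (e.open_target.preimage (by fun_prop)) (by
      intro x hx
      have h1 := heC' _ hx
      have h3 : ContDiffAt ℝ 2 (fun x : K => ((0, x) : Y × K)) x := by fun_prop
      exact contDiff_fst.contDiffAt.comp x (h1.comp x h3))
  refine measure_mono_null ?_ this
  rintro _ ⟨q, ⟨⟨hqZ, hns⟩, hqe⟩, rfl⟩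
  have heq : e q = (0, (e q).2) := by
    ext1
    · rw [he1, h0 q hqZ]
    · rfl
  set x := (e q).2 with hx
  have hsym : e.symm (0, x) = q := by rw [← heq]; exact e.left_inv hqe
  have hmem : ((0 : Y), x) ∈ e.target := by rw [← heq]; exact e.map_source hqe
  refine ⟨x, ⟨hmem, ?_⟩, by simp only [hsym]⟩
  intro hsurj
  apply hns
  set D := fderiv ℝ e.symm ((0 : Y), x) with hD
  have hDs : HasFDerivAt e.symm D ((0 : Y), x) :=
    ((heC' _ hmem).differentiableAt (by norm_num)).hasFDerivAt
  have hfq : HasFDerivAt f (fderiv ℝ f q) q :=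
    ((hf q hqZ).differentiableAt (by norm_num)).hasFDerivAt
  have hfq' : HasFDerivAt f (fderiv ℝ f q) (e.symm ((0 : Y), x)) := by rw [hsym]; exact hfq
  have hin : HasFDerivAt (fun x : K => ((0, x) : Y × K)) (ContinuousLinearMap.inr ℝ Y K) x :=
    hasFDerivAt_prodMk_right 0 x
  have hg : fderiv ℝ (fun x => (e.symm ((0 : Y), x)).1) x =
      (ContinuousLinearMap.fst ℝ C X).comp (D.comp (ContinuousLinearMap.inr ℝ Y K)) :=
    (hasFDerivAt_fst.comp x (hDs.comp x hin)).fderiv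
  rw [hg] at hsurj
  have hfst : (fderiv ℝ f q).comp D = ContinuousLinearMap.fst ℝ Y K := by
    refine (hfq'.comp _ hDs).unique (hasFDerivAt_fst.congr_of_eventuallyEq ?_)
    filter_upwards [e.open_target.mem_nhds hmem] with z hz
    simp only [Function.comp]
    rw [← he1, e.right_inv hz]
  have hfst' : ∀ z, fderiv ℝ f q (D z) = z.1 := fun z => congrArg (fun L => L z) hfst
  have hpart : fderiv ℝ (fun x => f (q.1, x)) q.2 =
      (fderiv ℝ f q).comp (ContinuousLinearMap.inr ℝ C X) :=
    (HasFDerivAt.comp (f := fun x : X => (q.1, x)) q.2 hfq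
      (hasFDerivAt_prodMk_right q.1 q.2)).fderiv
  rw [hpart]
  intro w
  obtain ⟨x', hx'⟩ := hsurj (D (w, 0)).1
  simp only [ContinuousLinearMap.comp_apply, ContinuousLinearMap.inr_apply,
      ContinuousLinearMap.coe_fst'] at hx'
  refine ⟨(D (w, 0)).2 - (D (0, x')).2, ?_⟩
  have hz : ((0, (D (w, 0)).2 - (D (0, x')).2) : C × X) = D (w, 0) - D (0, x') := by
    ext1
    · simp [hx']
    · simp
  rw [ContinuousLinearMap.comp_apply, ContinuousLinearMap.inr_apply, hz, map_sub, hfst', hfst']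
  simp

/-- Combining the Parametrized Sard's Theorem with the implicit function
theorem: if `ρ : ℝ^m × ℝ × ℝⁿ → ℝⁿ` is C² on an open neighborhood of
`U × (0,1) × V` and transversal to zero there, then for Lebesgue-almost every
`c ∈ U` the zero set of `ρ_c = ρ(c,·,·)` in `(0,1) × V` consists locally of
smooth non-intersecting curves. -/
theorem zero_set_of_homotopy_map_consists_of_smooth_curves
    (m n : ℕ)
    (U : Set (EuclideanSpace ℝ (Fin m))) (V : Set (EuclideanSpace ℝ (Fin n)))
    (hU : IsOpen U) (hV : IsOpen V)
    (ρ : EuclideanSpace ℝ (Fin m) × ℝ × EuclideanSpace ℝ (Fin n) →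
      EuclideanSpace ℝ (Fin n))
    (N : Set (EuclideanSpace ℝ (Fin m) × ℝ × EuclideanSpace ℝ (Fin n)))
    (hN : IsOpen N)
    (hNsub : U ×ˢ (Set.Ioo (0:ℝ) 1) ×ˢ V ⊆ N)
    (hC2 : ContDiffOn ℝ 2 ρ N)
    (htrans : ∀ c κ y, c ∈ U → κ ∈ Set.Ioo (0:ℝ) 1 → y ∈ V →
      ρ (c, κ, y) = 0 → Function.Surjective (fderiv ℝ ρ (c, κ, y))) :
    ∀ᵐ c ∂(volume : Measure (EuclideanSpace ℝ (Fin m))), c ∈ U →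
      ∀ κ y, κ ∈ Set.Ioo (0:ℝ) 1 → y ∈ V → ρ (c, κ, y) = 0 →
        ∃ ε > (0:ℝ),
          ∃ γ γ' : ℝ → ℝ × EuclideanSpace ℝ (Fin n),
            ∃ W : Set (ℝ × EuclideanSpace ℝ (Fin n)),
              IsOpen W ∧ (κ, y) ∈ W ∧
              γ 0 = (κ, y) ∧
              ContinuousOn γ' (Set.Ioo (-ε) ε) ∧
              (∀ s ∈ Set.Ioo (-ε) ε, HasDerivAt γ (γ' s) s) ∧
              (∀ s ∈ Set.Ioo (-ε) ε, γ' s ≠ 0) ∧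
              (∀ s ∈ Set.Ioo (-ε) ε, ρ (c, (γ s).1, (γ s).2) = 0) ∧
              {q ∈ W | ρ (c, q.1, q.2) = 0} = γ '' Set.Ioo (-ε) ε ∩ W := by
  set Z : Set (EuclideanSpace ℝ (Fin m) × ℝ × EuclideanSpace ℝ (Fin n)) :=
    {p | p ∈ U ×ˢ (Set.Ioo (0:ℝ) 1) ×ˢ V ∧ ρ p = 0} with hZ
  have hd : finrank ℝ (ℝ × EuclideanSpace ℝ (Fin n)) =
      finrank ℝ (EuclideanSpace ℝ (Fin n)) + 1 := by
    simp [add_comm]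
  have hc : ∀ p ∈ Z, ContDiffAt ℝ 2 ρ p := fun p hp =>
    hC2.contDiffAt (hN.mem_nhds (hNsub hp.1))
  have key := aux_param (volume : Measure (EuclideanSpace ℝ (Fin m))) hd ρ Z hc
    (fun p hp => hp.2) (fun p hp => htrans p.1 p.2.1 p.2.2 hp.1.1 hp.1.2.1 hp.1.2.2 hp.2)
  filter_upwards [compl_mem_ae_iff.2 key] with c hcm hcU κ y hκ hy h0
  have hpZ : (c, κ, y) ∈ Z := ⟨⟨hcU, hκ, hy⟩, h0⟩
  have hs : Function.Surjective (fderiv ℝ (fun x => ρ (c, x)) (κ, y)) := by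
    by_contra h
    exact hcm ⟨(c, κ, y), ⟨hpZ, h⟩, rfl⟩
  have hcd : ContDiffAt ℝ 2 (fun x => ρ (c, x)) (κ, y) :=
    ContDiffAt.comp (f := fun x : ℝ × EuclideanSpace ℝ (Fin n) => (c, x)) (κ, y) (hc _ hpZ)
      (by fun_prop)
  exact aux_curve hd (fun x => ρ (c, x)) (κ, y) hcd h0 hs
end
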